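/- Let A be a real d×d matrix and B_1,…,B_N real d×r_i matrices, and suppose the N-tuple of state-feedback gains (K_1,…,K_N) satisfies: every eigenvalue of A + Σ_{i=1}^N B_i K_i has negative real part, and for each j = 1,…,N every eigenvalue of A + Σ_{i≠j} B_i K_i has negative real part. Let σ : ℝ^d → ℝ^{d×m} be Lipschitz continuous and twice continuously differentiable with σ(x)σ(x)ᵀ ≥ κ I for some κ > 0, and let ε > 0 be sufficiently small. Let ρ^{(ε,0)} and ρ^{(ε,i)} (i ∈ {1,…,N}) be the unique smooth, strictly positive probability densities on ℝ^d solving the corresponding stationary Fokker–Planck equations (nominal and channel-i-failure closed loops, respectively). Then for each i ∈ {1,…,N} the relative entropy D(μ^{(ε,i)} ‖ μ^{(ε,0)}) = ∫_{ℝ^d} ρ^{(ε,i)}(x) log₂( ρ^{(ε,i)}(x) / ρ^{(ε,0)}(x) ) dx is finite. -/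

import Mathlib

open MeasureTheory Filter Matrix

/-- Partial derivative `∂f/∂x_k` of a scalar function on `ℝ^d`. -/
noncomputable def pd {d : ℕ} (k : Fin d) (f : (Fin d → ℝ) → ℝ) (x : Fin d → ℝ) : ℝ :=
  fderiv ℝ f x (Pi.single k 1)

/-- A real square matrix is Hurwitz if all its (complex) eigenvalues have
negative real part. -/
def IsHurwitz {d : ℕ} (M : Matrix (Fin d) (Fin d) ℝ) : Prop :=
  ∀ z ∈ spectrum ℂ (M.map (algebraMap ℝ ℂ)), z.re < 0

/-- `ρ` satisfies the stationary Fokker-Planck equation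
`0 = -∑ₖ ∂ₖ[(Mx)ₖ ρ] + (ε²/2) ∑ₖₗ ∂ₖ∂ₗ[(σσᵀ)ₖₗ ρ]` with linear drift `x ↦ Mx`
and diffusion coefficient `ε σ`. -/
def StatFP {d m : ℕ} (M : Matrix (Fin d) (Fin d) ℝ)
    (σ : (Fin d → ℝ) → Matrix (Fin d) (Fin m) ℝ) (ε : ℝ)
    (ρ : (Fin d → ℝ) → ℝ) : Prop :=
  ∀ x, (0 : ℝ) =
      -(∑ k, pd k (fun y => (M.mulVec y) k * ρ y) x) +
        (ε ^ 2 / 2) * ∑ k, ∑ l, pd k (pd l (fun y => (σ y * (σ y)ᵀ) k l * ρ y)) x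

/-- A smooth, everywhere strictly positive probability density on `ℝ^d`. -/
def NiceDensity {d : ℕ} (ρ : (Fin d → ℝ) → ℝ) : Prop :=
  ContDiff ℝ (⊤ : ℕ∞) ρ ∧ (∀ x, 0 < ρ x) ∧ (∫ x, ρ x) = 1

/-- `σ : ℝ^d → ℝ^{d×m}` is (entrywise) Lipschitz continuous. -/
def LipschitzCoeff {d m : ℕ} (σ : (Fin d → ℝ) → Matrix (Fin d) (Fin m) ℝ) : Prop :=
  ∃ L : ℝ, ∀ x y i j, |σ x i j - σ y i j| ≤ L * dist x y

/-- `σ : ℝ^d → ℝ^{d×m}` is twice continuously differentiable (entrywise). -/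
def C2Coeff {d m : ℕ} (σ : (Fin d → ℝ) → Matrix (Fin d) (Fin m) ℝ) : Prop :=
  ∀ i j, ContDiff ℝ 2 (fun x => σ x i j)

/-- Uniform ellipticity: `σ(x)σ(x)ᵀ ≥ κ I` for all `x`. -/
def UnifElliptic {d m : ℕ} (σ : (Fin d → ℝ) → Matrix (Fin d) (Fin m) ℝ) (κ : ℝ) : Prop :=
  ∀ x, (σ x * (σ x)ᵀ - κ • (1 : Matrix (Fin d) (Fin d) ℝ)).PosSemidef

/-! ### Lyapunov functions -/

theorem exists_pow_norm_lt {R : Type*} [NormedRing R] [NormedAlgebra ℂ R] [CompleteSpace R]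
    [Nontrivial R] (C : R) (h : ∀ z ∈ spectrum ℂ C, ‖z‖ < 1) (η : ℝ) (hη : 0 < η) :
    ∃ n : ℕ, 1 ≤ n ∧ ‖C ^ n‖ < η := by
  have h1 : spectralRadius ℂ C < ((1 : NNReal) : ENNReal) := by
    apply spectrum.spectralRadius_lt_of_forall_lt
    intro z hz
    have := h z hz
    exact_mod_cast this
  obtain ⟨q, hq1, hq2⟩ := ENNReal.lt_iff_exists_nnreal_btwn.1 h1
  have hq2' : (q : ℝ) < 1 := by exact_mod_cast hq2
  have h2 := (spectrum.pow_nnnorm_pow_one_div_tendsto_nhds_spectralRadius C).eventually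
    (gt_mem_nhds hq1)
  have h3 : Tendsto (fun n : ℕ => (q : ℝ) ^ n) atTop (nhds 0) :=
    tendsto_pow_atTop_nhds_zero_of_lt_one q.2 hq2'
  have h4 := h3.eventually (gt_mem_nhds hη)
  obtain ⟨n, hn1, hn2, hn3⟩ := (h2.and (h4.and (eventually_ge_atTop 1))).exists
  refine ⟨n, hn3, lt_of_le_of_lt ?_ hn2⟩
  have hn0 : (0 : ℝ) < n := by exact_mod_cast hn3
  have h5 : (‖C ^ n‖₊ : ENNReal) ≤ (q : ENNReal) ^ n := by
    have := ENNReal.rpow_le_rpow hn1.le hn0.le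
    rw [← ENNReal.rpow_mul, one_div, inv_mul_cancel₀ hn0.ne', ENNReal.rpow_one,
      ENNReal.rpow_natCast] at this
    exact this
  have h6 : ‖C ^ n‖₊ ≤ q ^ n := by exact_mod_cast h5
  exact_mod_cast h6

section lin
attribute [local instance] Matrix.linftyOpNormedRing Matrix.linftyOpNormedAlgebra

theorem exists_pow_entry_lt {d : ℕ} [NeZero d] (C : Matrix (Fin d) (Fin d) ℝ)
    (h : ∀ z ∈ spectrum ℂ (C.map (algebraMap ℝ ℂ)), ‖z‖ < 1) (η : ℝ) (hη : 0 < η) :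
    ∃ n : ℕ, 1 ≤ n ∧ ∀ i j, |(C ^ n) i j| ≤ η := by
  obtain ⟨n, hn, h2⟩ := exists_pow_norm_lt (C.map (algebraMap ℝ ℂ)) h η hη
  refine ⟨n, hn, fun i j => le_trans ?_ h2.le⟩
  have h3 : (C.map (algebraMap ℝ ℂ)) ^ n = (C ^ n).map (algebraMap ℝ ℂ) := by
    have := map_pow ((algebraMap ℝ ℂ).mapMatrix) C n
    simpa using this.symm
  rw [h3, Matrix.linfty_opNorm_def]
  have h4 : ‖(C ^ n).map (algebraMap ℝ ℂ) i j‖₊ ≤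
      Finset.univ.sup fun i => ∑ j, ‖(C ^ n).map (algebraMap ℝ ℂ) i j‖₊ := by
    refine le_trans ?_ (Finset.le_sup (f := fun i => ∑ j, ‖(C ^ n).map (algebraMap ℝ ℂ) i j‖₊)
      (Finset.mem_univ i))
    exact Finset.single_le_sum (f := fun j => ‖(C ^ n).map (algebraMap ℝ ℂ) i j‖₊)
      (fun _ _ => zero_le) (Finset.mem_univ j)
  have h5 : |(C ^ n) i j| = ((‖(C ^ n).map (algebraMap ℝ ℂ) i j‖₊ : NNReal) : ℝ) := by
    simp
  rw [h5]
  exact_mod_cast h4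

end lin

theorem isUnit_smul_ne {R : Type*} [Ring R] [Algebra ℂ R] {c : ℂ} (hc : c ≠ 0) {a : R}
    (ha : IsUnit a) : IsUnit (c • a) :=
  (isUnit_smul_iff (Units.mk0 c hc) a).2 ha

theorem cayley {d : ℕ} (M : Matrix (Fin d) (Fin d) ℝ) (hM : IsHurwitz M) :
    ∃ R : Matrix (Fin d) (Fin d) ℝ, R * (M - 1) = 1 ∧
      ∀ z ∈ spectrum ℂ (((M + 1) * R).map (algebraMap ℝ ℂ)), ‖z‖ < 1 := by
  set f := (algebraMap ℝ ℂ).mapMatrix (m := Fin d) with hf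
  have hM' : ∀ z ∈ spectrum ℂ (f M), z.re < 0 := hM
  have h1 : IsUnit (f M - 1) := by
    by_contra hcon
    have : (1 : ℂ) ∈ spectrum ℂ (f M) := by
      rw [spectrum.mem_iff]
      intro h
      apply hcon
      rw [← IsUnit.neg_iff]
      simpa using h
    have := hM' 1 this
    norm_num at this
  have h2 : IsUnit (M - 1) := by
    rw [Matrix.isUnit_iff_isUnit_det] at h1 ⊢
    have h3 : f M - 1 = f (M - 1) := by simp
    rw [h3, hf, ← RingHom.map_det] at h1
    rw [isUnit_iff_ne_zero] at h1 ⊢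
    intro h; apply h1; rw [h]; simp
  obtain ⟨u, hu⟩ := h2
  have hR1 : (↑u⁻¹ : Matrix (Fin d) (Fin d) ℝ) * (M - 1) = 1 := by rw [← hu]; simp
  have hR2 : (M - 1) * (↑u⁻¹ : Matrix (Fin d) (Fin d) ℝ) = 1 := by rw [← hu]; simp
  generalize (↑u⁻¹ : Matrix (Fin d) (Fin d) ℝ) = R at hR1 hR2
  refine ⟨R, hR1, fun z hz => ?_⟩
  by_contra hz1
  push Not at hz1
  change z ∈ spectrum ℂ (f ((M + 1) * R)) at hz
  rw [spectrum.mem_iff] at hz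
  apply hz
  have e1 : (f M - 1) * f R = 1 := by
    have := congrArg f hR2
    simpa using this
  have e2 : f R * (f M - 1) = 1 := by
    have := congrArg f hR1
    simpa using this
  have hRu : IsUnit (f R) := ⟨⟨f R, f M - 1, e2, e1⟩, rfl⟩
  have e3 : algebraMap ℂ (Matrix (Fin d) (Fin d) ℂ) z - f ((M + 1) * R) =
      (z • (f M - 1) - (f M + 1)) * f R := by
    rw [sub_mul, smul_mul_assoc, e1]
    simp [Algebra.algebraMap_eq_smul_one]
  rw [e3]
  refine IsUnit.mul ?_ hRu
  by_cases hz2 : z = 1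
  · subst hz2
    have : (1 : ℂ) • (f M - 1) - (f M + 1) = (-2 : ℂ) • (1 : Matrix (Fin d) (Fin d) ℂ) := by
      rw [one_smul]
      have : (-2 : ℂ) • (1 : Matrix (Fin d) (Fin d) ℂ) = -1 - 1 := by
        rw [← neg_one_smul ℂ (1 : Matrix (Fin d) (Fin d) ℂ)]
        module
      rw [this]; abel
    rw [this]
    exact isUnit_smul_ne (by norm_num) isUnit_one
  · have hz3 : z - 1 ≠ 0 := sub_ne_zero.2 hz2
    have hw : ¬ ((z + 1) / (z - 1) ∈ spectrum ℂ (f M)) := by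
      intro h
      have h4 := hM' _ h
      rw [Complex.div_re, ← add_div] at h4
      have h5 : 0 < Complex.normSq (z - 1) := Complex.normSq_pos.2 hz3
      have h6 : (z + 1).re * (z - 1).re + (z + 1).im * (z - 1).im = ‖z‖ ^ 2 - 1 := by
        rw [Complex.sq_norm, Complex.normSq_apply]
        simp; ring
      rw [h6] at h4
      have : 0 ≤ (‖z‖ ^ 2 - 1) / Complex.normSq (z - 1) := by
        apply div_nonneg _ h5.le
        nlinarith
      linarith
    rw [spectrum.mem_iff, not_not] at hw
    have e4 : z • (f M - 1) - (f M + 1) = (-(z - 1)) •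
        (algebraMap ℂ (Matrix (Fin d) (Fin d) ℂ) ((z + 1) / (z - 1)) - f M) := by
      rw [Algebra.algebraMap_eq_smul_one, smul_sub (-(z - 1)), smul_smul]
      have : -(z - 1) * ((z + 1) / (z - 1)) = -(z + 1) := by field_simp
      rw [this]
      module
    rw [e4]
    exact isUnit_smul_ne (neg_ne_zero.2 hz3) hw

theorem mulVec_sq_le {d e : ℕ} (A : Matrix (Fin e) (Fin d) ℝ) (η : ℝ) (h : ∀ i j, |A i j| ≤ η)
    (x : Fin d → ℝ) : (A *ᵥ x) ⬝ᵥ (A *ᵥ x) ≤ (e * d * η ^ 2) * (x ⬝ᵥ x) := by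
  have h1 : ∀ i, (A *ᵥ x) i * (A *ᵥ x) i ≤ d * η ^ 2 * (x ⬝ᵥ x) := by
    intro i
    have h2 := Finset.sum_mul_sq_le_sq_mul_sq Finset.univ (fun j => A i j) x
    have h3 : ∑ j, A i j ^ 2 ≤ d * η ^ 2 := by
      calc ∑ j, A i j ^ 2 ≤ ∑ j : Fin d, η ^ 2 :=
            Finset.sum_le_sum fun j _ => sq_le_sq' (abs_le.1 (h i j)).1 (abs_le.1 (h i j)).2
        _ = d * η ^ 2 := by simp
    have h4 : ∑ j, x j ^ 2 = x ⬝ᵥ x := by simp [dotProduct, sq]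
    have h5 : 0 ≤ x ⬝ᵥ x := by rw [← h4]; positivity
    calc (A *ᵥ x) i * (A *ᵥ x) i = (∑ j, A i j * x j) ^ 2 := by simp [mulVec, dotProduct, sq]
      _ ≤ _ := h2
      _ ≤ _ := by rw [h4]; gcongr
  calc (A *ᵥ x) ⬝ᵥ (A *ᵥ x) = ∑ i, (A *ᵥ x) i * (A *ᵥ x) i := rfl
    _ ≤ ∑ i : Fin e, d * η ^ 2 * (x ⬝ᵥ x) := Finset.sum_le_sum fun i _ => h1 i
    _ = _ := by simp; ring

theorem mulVec_sq_le' {d e : ℕ} (A : Matrix (Fin e) (Fin d) ℝ) : ∃ K : ℝ, 0 < K ∧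
    ∀ x : Fin d → ℝ, (A *ᵥ x) ⬝ᵥ (A *ᵥ x) ≤ K * (x ⬝ᵥ x) := by
  set η := ∑ i, ∑ j, |A i j|
  have hη : ∀ i j, |A i j| ≤ η := by
    intro i j
    calc |A i j| ≤ ∑ j, |A i j| :=
          Finset.single_le_sum (f := fun j => |A i j|) (fun _ _ => abs_nonneg _) (Finset.mem_univ j)
      _ ≤ η := Finset.single_le_sum (f := fun i => ∑ j, |A i j|)
          (fun _ _ => Finset.sum_nonneg fun _ _ => abs_nonneg _) (Finset.mem_univ i)
  refine ⟨e * d * η ^ 2 + 1, by positivity, fun x => (mulVec_sq_le A η hη x).trans ?_⟩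
  have h5 : 0 ≤ x ⬝ᵥ x := Finset.sum_nonneg fun i _ => mul_self_nonneg _
  nlinarith

theorem dot_self_nonneg {d : ℕ} (x : Fin d → ℝ) : 0 ≤ x ⬝ᵥ x :=
  Finset.sum_nonneg fun _ _ => mul_self_nonneg _

theorem exists_lyapunov {d : ℕ} (M : Matrix (Fin d) (Fin d) ℝ) (hM : IsHurwitz M) :
    ∃ P : Matrix (Fin d) (Fin d) ℝ, Pᵀ = P ∧ (∀ x : Fin d → ℝ, x ⬝ᵥ x ≤ x ⬝ᵥ (P *ᵥ x)) ∧
      ∃ r : ℝ, 0 < r ∧ ∀ x : Fin d → ℝ, (P *ᵥ x) ⬝ᵥ (M *ᵥ x) ≤ -r * (x ⬝ᵥ x) := by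
  rcases Nat.eq_zero_or_pos d with rfl | hd
  · exact ⟨1, by simp, by simp, 1, one_pos, by simp⟩
  have : NeZero d := ⟨hd.ne'⟩
  have hd' : (0 : ℝ) < d := by exact_mod_cast hd
  obtain ⟨R, hR, hsp⟩ := cayley M hM
  obtain ⟨N, hN, hC⟩ := exists_pow_entry_lt ((M + 1) * R) hsp (1 / (2 * d)) (by positivity)
  obtain ⟨K, hK, hRK⟩ := mulVec_sq_le' R
  set C := (M + 1) * R with hCdef
  set P : Matrix (Fin d) (Fin d) ℝ := ∑ n ∈ Finset.range N, (C ^ n)ᵀ * C ^ n with hP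
  have hB : ∀ x y : Fin d → ℝ, x ⬝ᵥ (P *ᵥ y) =
      ∑ n ∈ Finset.range N, ((C ^ n) *ᵥ x) ⬝ᵥ ((C ^ n) *ᵥ y) := by
    intro x y
    rw [hP, Matrix.sum_mulVec, dotProduct_sum]
    refine Finset.sum_congr rfl fun n _ => ?_
    rw [← mulVec_mulVec, dotProduct_mulVec, vecMul_transpose]
  refine ⟨P, ?_, ?_, 1 / (8 * K), by positivity, ?_⟩
  · rw [hP, Matrix.transpose_sum]
    simp [Matrix.transpose_mul]
  · intro x
    rw [hB]
    have := Finset.single_le_sum (f := fun n => ((C ^ n) *ᵥ x) ⬝ᵥ ((C ^ n) *ᵥ x))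
      (fun n _ => dot_self_nonneg _) (Finset.mem_range.2 hN)
    simpa using this
  · intro y
    set x := (M - 1) *ᵥ y with hx
    have hCx : C *ᵥ x = (M + 1) *ᵥ y := by
      rw [hx, mulVec_mulVec, hCdef, mul_assoc, hR, mul_one]
    have hRx : R *ᵥ x = y := by rw [hx, mulVec_mulVec, hR, one_mulVec]
    have h1 : x ⬝ᵥ (P *ᵥ x) - (C *ᵥ x) ⬝ᵥ (P *ᵥ (C *ᵥ x)) =
        x ⬝ᵥ x - (C ^ N *ᵥ x) ⬝ᵥ (C ^ N *ᵥ x) := by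
      rw [hB, hB, ← Finset.sum_sub_distrib]
      have := Finset.sum_range_sub' (fun n => ((C ^ n) *ᵥ x) ⬝ᵥ ((C ^ n) *ᵥ x)) N
      simp only [pow_zero, one_mulVec] at this
      rw [← this]
      refine Finset.sum_congr rfl fun n _ => ?_
      have : C ^ (n + 1) *ᵥ x = C ^ n *ᵥ (C *ᵥ x) := by
        rw [pow_succ]; exact (mulVec_mulVec _ _ _).symm
      rw [this]
    have hsymm : ∀ u w : Fin d → ℝ, u ⬝ᵥ (P *ᵥ w) = w ⬝ᵥ (P *ᵥ u) := by
      intro u w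
      rw [hB, hB]
      exact Finset.sum_congr rfl fun n _ => dotProduct_comm _ _
    have h2 : x ⬝ᵥ (P *ᵥ x) - (C *ᵥ x) ⬝ᵥ (P *ᵥ (C *ᵥ x)) = -4 * ((P *ᵥ y) ⬝ᵥ (M *ᵥ y)) := by
      rw [hCx, hx, sub_mulVec, add_mulVec, one_mulVec, mulVec_sub, mulVec_add]
      simp only [add_dotProduct, sub_dotProduct, dotProduct_add, dotProduct_sub]
      rw [hsymm y (M *ᵥ y), dotProduct_comm (P *ᵥ y)]
      ring
    have h3 := mulVec_sq_le (C ^ N) _ hC x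
    have h4 : (d * d * (1 / (2 * d)) ^ 2 : ℝ) = 1 / 4 := by field_simp; norm_num
    rw [h4] at h3
    have h5 := hRK x
    rw [hRx] at h5
    have h6 : 0 ≤ x ⬝ᵥ x := dot_self_nonneg x
    have h7 : 1 / (8 * K) * (y ⬝ᵥ y) ≤ 1 / 8 * (x ⬝ᵥ x) := by
      rw [div_mul_eq_mul_div, div_le_iff₀ (by positivity)]
      nlinarith
    nlinarith

/-! ### Calculus with `pd` -/

theorem pd_mul {d : ℕ} {k : Fin d} {f g : (Fin d → ℝ) → ℝ} {x : Fin d → ℝ}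
    (hf : DifferentiableAt ℝ f x) (hg : DifferentiableAt ℝ g x) :
    pd k (fun y => f y * g y) x = pd k f x * g x + f x * pd k g x := by
  unfold pd
  rw [fderiv_fun_mul hf hg]
  simp
  ring

theorem pd_add {d : ℕ} {k : Fin d} {f g : (Fin d → ℝ) → ℝ} {x : Fin d → ℝ}
    (hf : DifferentiableAt ℝ f x) (hg : DifferentiableAt ℝ g x) :
    pd k (fun y => f y + g y) x = pd k f x + pd k g x := by
  unfold pd
  rw [fderiv_fun_add hf hg]
  simp

theorem pd_sub {d : ℕ} {k : Fin d} {f g : (Fin d → ℝ) → ℝ} {x : Fin d → ℝ}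
    (hf : DifferentiableAt ℝ f x) (hg : DifferentiableAt ℝ g x) :
    pd k (fun y => f y - g y) x = pd k f x - pd k g x := by
  unfold pd
  rw [fderiv_fun_sub hf hg]
  simp

theorem pd_const_mul {d : ℕ} {k : Fin d} {f : (Fin d → ℝ) → ℝ} {x : Fin d → ℝ} (c : ℝ)
    (hf : DifferentiableAt ℝ f x) :
    pd k (fun y => c * f y) x = c * pd k f x := by
  unfold pd
  rw [fderiv_const_mul hf]
  simp

theorem pd_sum {d : ℕ} {ι : Type*} {s : Finset ι} {k : Fin d} {f : ι → (Fin d → ℝ) → ℝ}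
    {x : Fin d → ℝ} (hf : ∀ i ∈ s, DifferentiableAt ℝ (f i) x) :
    pd k (fun y => ∑ i ∈ s, f i y) x = ∑ i ∈ s, pd k (f i) x := by
  unfold pd
  rw [fderiv_fun_sum hf]
  simp

theorem pd_comp {d : ℕ} {k : Fin d} {g : ℝ → ℝ} {g' : ℝ} {f : (Fin d → ℝ) → ℝ}
    {x : Fin d → ℝ} (hg : HasDerivAt g g' (f x)) (hf : DifferentiableAt ℝ f x) :
    pd k (fun y => g (f y)) x = g' * pd k f x := by
  unfold pd
  have := (hg.comp_hasFDerivAt x hf.hasFDerivAt).fderiv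
  have h2 : fderiv ℝ (fun y => g (f y)) x = g' • fderiv ℝ f x := this
  rw [h2]; simp

theorem contDiff_pd {d : ℕ} {k : Fin d} {f : (Fin d → ℝ) → ℝ} {n m : WithTop ℕ∞}
    (hf : ContDiff ℝ n f) (h : m + 1 ≤ n) : ContDiff ℝ m (pd k f) := by
  unfold pd
  exact (hf.fderiv_right h).clm_apply contDiff_const

theorem pd_compact {d : ℕ} {k : Fin d} {f : (Fin d → ℝ) → ℝ} (hf : ContDiff ℝ 1 f)
    (hc : HasCompactSupport f) : Integrable (pd k f) ∧ ∫ x, pd k f x = 0 := by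
  have hcont : Continuous (pd k f) := (contDiff_pd (m := 0) hf (by norm_num)).continuous
  have hcs : HasCompactSupport (pd k f) := by
    have := hc.fderiv (𝕜 := ℝ)
    exact this.comp_left (g := fun L : (Fin d → ℝ) →L[ℝ] ℝ => L (Pi.single k 1)) rfl
  have hInt : Integrable (pd k f) := hcont.integrable_of_hasCompactSupport hcs
  refine ⟨hInt, ?_⟩
  have := integral_mul_fderiv_eq_neg_fderiv_mul_of_integrable (μ := (volume : Measure (Fin d → ℝ)))
    (f := fun _ => (1 : ℝ)) (g := f)
    (v := Pi.single k 1) (by simp) (by simp only [one_mul]; exact hInt)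
    (by simpa using hf.continuous.integrable_of_hasCompactSupport hc)
    (fun x _ => by fun_prop) (fun x _ => (hf.differentiable (by norm_num)).differentiableAt)
  simp only [one_mul, fderiv_fun_const, Pi.zero_apply, _root_.zero_apply, zero_mul,
    integral_zero, neg_zero] at this
  exact this

theorem div_compact {d : ℕ} {X : Fin d → (Fin d → ℝ) → ℝ} (hf : ∀ k, ContDiff ℝ 1 (X k))
    (hc : ∀ k, HasCompactSupport (X k)) :
    Integrable (fun x => ∑ k, pd k (X k) x) ∧ ∫ x, ∑ k, pd k (X k) x = 0 := by
  refine ⟨integrable_finsetSum _ fun k _ => (pd_compact (hf k) (hc k)).1, ?_⟩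
  rw [integral_finsetSum _ fun k _ => (pd_compact (hf k) (hc k)).1]
  exact Finset.sum_eq_zero fun k _ => (pd_compact (hf k) (hc k)).2

/-- Pure algebra behind the divergence identity. -/
theorem div_algebra {d : ℕ} (c W S T q v p0 p1 : ℝ) (dW dv dp0 dp1 b0 b1 J0 J1 : Fin d → ℝ)
    (a e D2 : Fin d → Fin d → ℝ) (hsymm : ∀ k l, a k l = a l k) (hp : p1 = v * p0)
    (hdp : ∀ k, dp1 k = dv k * p0 + v * dp0 k)
    (hJ0 : ∀ k, J0 k = c * ∑ l, (e k l * p0 + a k l * dp0 l) - b0 k * p0)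
    (hJ1 : ∀ k, J1 k = c * ∑ l, (e k l * p1 + a k l * dp1 l) - b1 k * p1) :
    (∑ k, (dW k * (S * J1 k + T * J0 k) + W * (q * dv k * J1 k - v * q * dv k * J0 k)
      - c * ((dp0 k * T + dp1 k * S) * (∑ l, a k l * dW l)
        + (p0 * T + p1 * S) * ∑ l, (e l k * dW l + a k l * D2 k l)))) =
    W * q * (c * p0 * (∑ k, ∑ l, a k l * dv k * dv l) - p1 * ∑ k, (b1 k - b0 k) * dv k)
    - (p0 * T + p1 * S) * (∑ k, b1 k * dW k + c * ∑ k, ∑ l, a k l * D2 k l)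
    + (p0 * T) * ∑ k, (b1 k - b0 k) * dW k := by
  have hE : ∀ k, J0 k = c * (p0 * (∑ l, e k l) + ∑ l, a k l * dp0 l) - b0 k * p0 := by
    intro k; rw [hJ0, Finset.sum_add_distrib, Finset.mul_sum]; simp only [mul_comm p0]
  have hE1 : ∀ k, J1 k = c * (p1 * (∑ l, e k l) + (p0 * (∑ l, a k l * dv l) +
      v * (∑ l, a k l * dp0 l))) - b1 k * p1 := by
    intro k
    have h1 : ∑ l, a k l * dp1 l = p0 * (∑ l, a k l * dv l) + v * (∑ l, a k l * dp0 l) := by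
      rw [Finset.mul_sum, Finset.mul_sum, ← Finset.sum_add_distrib]
      exact Finset.sum_congr rfl fun l _ => by rw [hdp]; ring
    rw [hJ1, Finset.sum_add_distrib, ← Finset.sum_mul, h1, mul_comm p1]
  have sw : ∀ u : Fin d → ℝ, ∑ k, dW k * ∑ l, a k l * u l = ∑ k, u k * ∑ l, a k l * dW l := by
    intro u
    simp only [Finset.mul_sum]
    rw [Finset.sum_comm]
    refine Finset.sum_congr rfl fun k _ => Finset.sum_congr rfl fun l _ => ?_
    rw [hsymm l k]; ring
  have swe : ∑ k, ∑ l, e l k * dW l = ∑ k, dW k * ∑ l, e k l := by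
    rw [Finset.sum_comm]
    refine Finset.sum_congr rfl fun k _ => ?_
    rw [Finset.mul_sum]
    exact Finset.sum_congr rfl fun l _ => mul_comm _ _
  have q1 : ∑ k, ∑ l, a k l * dv k * dv l = ∑ k, dv k * ∑ l, a k l * dv l := by
    refine Finset.sum_congr rfl fun k _ => ?_
    rw [Finset.mul_sum]
    exact Finset.sum_congr rfl fun l _ => by ring
  have s0 := sw dp0
  have s1 := sw dv
  have key : ∀ k, (dW k * (S * J1 k + T * J0 k) + W * (q * dv k * J1 k - v * q * dv k * J0 k)
      - c * ((dp0 k * T + dp1 k * S) * (∑ l, a k l * dW l)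
        + (p0 * T + p1 * S) * ∑ l, (e l k * dW l + a k l * D2 k l))) =
      (c * (p0 * T + p1 * S)) * (dW k * ∑ l, e k l)
      + (c * S * p0) * (dW k * ∑ l, a k l * dv l)
      + (c * (S * v + T)) * (dW k * ∑ l, a k l * dp0 l)
      - (c * S * p0) * (dv k * ∑ l, a k l * dW l)
      - (c * (S * v + T)) * (dp0 k * ∑ l, a k l * dW l)
      - (p0 * T + p1 * S) * (b1 k * dW k) + (p0 * T) * ((b1 k - b0 k) * dW k)
      + (W * q * (c * p0)) * (dv k * ∑ l, a k l * dv l)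
      - (W * q * p1) * ((b1 k - b0 k) * dv k)
      - (c * (p0 * T + p1 * S)) * (∑ l, e l k * dW l)
      - (c * (p0 * T + p1 * S)) * (∑ l, a k l * D2 k l) := by
    intro k
    rw [hE, hE1, hdp, Finset.sum_add_distrib, hp]
    ring
  rw [Finset.sum_congr rfl fun k _ => key k]
  simp only [Finset.sum_add_distrib, Finset.sum_sub_distrib, ← Finset.mul_sum]
  rw [q1, swe, s0, s1]
  ring

/-! ### The integrated identity -/

/-- The probability flux. -/
noncomputable def flux {d : ℕ} (c : ℝ) (a : Fin d → Fin d → (Fin d → ℝ) → ℝ)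
    (b : Fin d → (Fin d → ℝ) → ℝ) (ρ : (Fin d → ℝ) → ℝ) (k : Fin d) (y : Fin d → ℝ) : ℝ :=
  c * (∑ l, pd l (fun z => a k l z * ρ z) y) - b k y * ρ y

theorem contDiff_flux {d : ℕ} (c : ℝ) (a : Fin d → Fin d → (Fin d → ℝ) → ℝ)
    (b : Fin d → (Fin d → ℝ) → ℝ) (ρ : (Fin d → ℝ) → ℝ) (ha : ∀ k l, ContDiff ℝ 2 (a k l))
    (hb : ∀ k, ContDiff ℝ 1 (b k)) (hρ : ContDiff ℝ 2 ρ) (k : Fin d) :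
    ContDiff ℝ 1 (flux c a b ρ k) := by
  unfold flux
  refine (contDiff_const.mul (ContDiff.sum fun l _ => ?_)).sub
    ((hb k).mul (hρ.of_le (by norm_num)))
  exact contDiff_pd ((ha k l).mul hρ) (by norm_num)

theorem div_flux {d : ℕ} (c : ℝ) (a : Fin d → Fin d → (Fin d → ℝ) → ℝ)
    (b : Fin d → (Fin d → ℝ) → ℝ) (ρ : (Fin d → ℝ) → ℝ) (ha : ∀ k l, ContDiff ℝ 2 (a k l))
    (hb : ∀ k, ContDiff ℝ 1 (b k)) (hρ : ContDiff ℝ 2 ρ)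
    (hFP : ∀ x, (0 : ℝ) = -(∑ k, pd k (fun y => b k y * ρ y) x) +
        c * ∑ k, ∑ l, pd k (pd l (fun y => a k l y * ρ y)) x) (x : Fin d → ℝ) :
    ∑ k, pd k (flux c a b ρ k) x = 0 := by
  have hd : ∀ k l, DifferentiableAt ℝ (pd l (fun z => a k l z * ρ z)) x := fun k l =>
    ((contDiff_pd (m := 1) ((ha k l).mul hρ) (by norm_num)).differentiable
      (by norm_num)).differentiableAt
  have hd2 : ∀ k, DifferentiableAt ℝ (fun y => b k y * ρ y) x := fun k =>
    (((hb k).mul (hρ.of_le (by norm_num))).differentiable (by norm_num)).differentiableAt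
  have hk : ∀ k, pd k (flux c a b ρ k) x =
      c * (∑ l, pd k (pd l (fun y => a k l y * ρ y)) x) - pd k (fun y => b k y * ρ y) x := by
    intro k
    unfold flux
    rw [pd_sub _ (hd2 k), pd_const_mul, pd_sum]
    · exact fun l _ => hd k l
    · exact DifferentiableAt.fun_sum fun l _ => hd k l
    · exact (DifferentiableAt.fun_sum fun l _ => hd k l).const_mul c
  rw [Finset.sum_congr rfl fun k _ => hk k, Finset.sum_sub_distrib, ← Finset.mul_sum]
  linarith [hFP x]

theorem int_identity {d : ℕ} (c : ℝ) (a : Fin d → Fin d → (Fin d → ℝ) → ℝ)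
    (ha : ∀ k l, ContDiff ℝ 2 (a k l)) (hsymm : ∀ k l, a k l = a l k)
    (b0 b1 : Fin d → (Fin d → ℝ) → ℝ)
    (hb0 : ∀ k, ContDiff ℝ 1 (b0 k)) (hb1 : ∀ k, ContDiff ℝ 1 (b1 k))
    (ρ0 ρ1 v : (Fin d → ℝ) → ℝ) (hρ0 : ContDiff ℝ 2 ρ0) (hρ1 : ContDiff ℝ 2 ρ1)
    (hv : ContDiff ℝ 1 v) (hvρ : ∀ x, ρ1 x = v x * ρ0 x)
    (hFP0 : ∀ x, (0 : ℝ) = -(∑ k, pd k (fun y => b0 k y * ρ0 y) x) +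
        c * ∑ k, ∑ l, pd k (pd l (fun y => a k l y * ρ0 y)) x)
    (hFP1 : ∀ x, (0 : ℝ) = -(∑ k, pd k (fun y => b1 k y * ρ1 y) x) +
        c * ∑ k, ∑ l, pd k (pd l (fun y => a k l y * ρ1 y)) x)
    (S T q : (Fin d → ℝ) → ℝ) (hS : ContDiff ℝ 1 S) (hT : ContDiff ℝ 1 T)
    (hSd : ∀ k x, pd k S x = q x * pd k v x) (hTd : ∀ k x, pd k T x = -(v x * q x * pd k v x))
    (W : (Fin d → ℝ) → ℝ) (hW : ContDiff ℝ 2 W) (hWc : HasCompactSupport W) :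
    ∃ D : (Fin d → ℝ) → ℝ, Integrable D ∧ ∫ x, D x = 0 ∧ ∀ x, D x =
      W x * q x * (c * ρ0 x * (∑ k, ∑ l, a k l x * pd k v x * pd l v x)
        - ρ1 x * ∑ k, (b1 k x - b0 k x) * pd k v x)
      - (ρ0 x * T x + ρ1 x * S x) *
        (∑ k, b1 k x * pd k W x + c * ∑ k, ∑ l, a k l x * pd k (pd l W) x)
      + (ρ0 x * T x) * ∑ k, (b1 k x - b0 k x) * pd k W x := by
  have hρ0' : ContDiff ℝ 1 ρ0 := hρ0.of_le (by norm_num)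
  have hρ1' : ContDiff ℝ 1 ρ1 := hρ1.of_le (by norm_num)
  have hW' : ContDiff ℝ 1 W := hW.of_le (by norm_num)
  have ha' : ∀ k l, ContDiff ℝ 1 (a k l) := fun k l => (ha k l).of_le (by norm_num)
  have hJ0 := contDiff_flux c a b0 ρ0 ha hb0 hρ0
  have hJ1 := contDiff_flux c a b1 ρ1 ha hb1 hρ1
  have hdW : ∀ l, ContDiff ℝ 1 (pd l W) := fun l => contDiff_pd hW (by norm_num)
  have df : ∀ {f : (Fin d → ℝ) → ℝ}, ContDiff ℝ 1 f → ∀ x, DifferentiableAt ℝ f x :=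
    fun h x => (h.differentiable (by norm_num)).differentiableAt
  let X : Fin d → (Fin d → ℝ) → ℝ := fun k y =>
    W y * (S y * flux c a b1 ρ1 k y + T y * flux c a b0 ρ0 k y)
      - c * ((ρ0 y * T y + ρ1 y * S y) * ∑ l, a k l y * pd l W y)
  have hX1 : ∀ k, ContDiff ℝ 1 (fun y => S y * flux c a b1 ρ1 k y + T y * flux c a b0 ρ0 k y) :=
    fun k => (hS.mul (hJ1 k)).add (hT.mul (hJ0 k))
  have hX2 : ContDiff ℝ 1 (fun y => ρ0 y * T y + ρ1 y * S y) := (hρ0'.mul hT).add (hρ1'.mul hS)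
  have hX3 : ∀ k, ContDiff ℝ 1 (fun y => ∑ l, a k l y * pd l W y) := fun k =>
    ContDiff.sum fun l _ => (ha' k l).mul (hdW l)
  have hX : ∀ k, ContDiff ℝ 1 (X k) := fun k =>
    (hW'.mul (hX1 k)).sub (contDiff_const.mul (hX2.mul (hX3 k)))
  have hXc : ∀ k, HasCompactSupport (X k) := by
    intro k
    have hz : ∀ y, y ∉ tsupport W → X k y = 0 := by
      intro y hy
      have h1 : W y = 0 := image_eq_zero_of_notMem_tsupport hy
      have h2 : ∀ l, pd l W y = 0 := by
        intro l
        have : fderiv ℝ W y = 0 := by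
          by_contra h
          exact hy (support_fderiv_subset ℝ h)
        simp [pd, this]
      simp [X, h1, h2]
    exact HasCompactSupport.intro hWc hz
  refine ⟨_, (div_compact hX hXc).1, (div_compact hX hXc).2, fun x => ?_⟩
  have hsum0 := div_flux c a b0 ρ0 ha hb0 hρ0 hFP0 x
  have hsum1 := div_flux c a b1 ρ1 ha hb1 hρ1 hFP1 x
  have hdρ : ∀ k, pd k ρ1 x = pd k v x * ρ0 x + v x * pd k ρ0 x := by
    intro k
    have : ρ1 = fun y => v y * ρ0 y := funext hvρ
    rw [this, pd_mul (df hv x) (df hρ0' x)]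
  have hfl : ∀ (b : Fin d → (Fin d → ℝ) → ℝ) (ρ : (Fin d → ℝ) → ℝ), ContDiff ℝ 1 ρ → ∀ k,
      flux c a b ρ k x = c * ∑ l, (pd l (a k l) x * ρ x + a k l x * pd l ρ x) - b k x * ρ x := by
    intro b ρ hρ k
    unfold flux
    rw [Finset.sum_congr rfl fun l _ => pd_mul (df (ha' k l) x) (df hρ x)]
  have main := div_algebra c (W x) (S x) (T x) (q x) (v x) (ρ0 x) (ρ1 x)
    (fun k => pd k W x) (fun k => pd k v x) (fun k => pd k ρ0 x) (fun k => pd k ρ1 x)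
    (fun k => b0 k x) (fun k => b1 k x) (fun k => flux c a b0 ρ0 k x)
    (fun k => flux c a b1 ρ1 k x) (fun k l => a k l x) (fun k l => pd l (a k l) x)
    (fun k l => pd k (pd l W) x) (fun k l => by rw [hsymm]) (hvρ x) hdρ
    (hfl b0 ρ0 hρ0') (hfl b1 ρ1 hρ1')
  rw [← main]
  have hXk : ∀ k, pd k (X k) x =
      (pd k W x * (S x * flux c a b1 ρ1 k x + T x * flux c a b0 ρ0 k x)
        + W x * (q x * pd k v x * flux c a b1 ρ1 k x - v x * q x * pd k v x * flux c a b0 ρ0 k x)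
      - c * ((pd k ρ0 x * T x + pd k ρ1 x * S x) * (∑ l, a k l x * pd l W x)
        + (ρ0 x * T x + ρ1 x * S x) *
          ∑ l, (pd k (a l k) x * pd l W x + a k l x * pd k (pd l W) x)))
      + ((W x * S x) * pd k (flux c a b1 ρ1 k) x + (W x * T x) * pd k (flux c a b0 ρ0 k) x) := by
    intro k
    simp only [X]
    rw [pd_sub (df (hW'.mul (hX1 k)) x) (df (contDiff_const.mul (hX2.mul (hX3 k))) x),
      pd_mul (df hW' x) (df (hX1 k) x),
      pd_add (df (hS.mul (hJ1 k)) x) (df (hT.mul (hJ0 k)) x),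
      pd_mul (df hS x) (df (hJ1 k) x), pd_mul (df hT x) (df (hJ0 k) x),
      pd_const_mul _ (df (hX2.mul (hX3 k)) x), pd_mul (df hX2 x) (df (hX3 k) x),
      pd_add (df (hρ0'.mul hT) x) (df (hρ1'.mul hS) x),
      pd_mul (df hρ0' x) (df hT x), pd_mul (df hρ1' x) (df hS x),
      pd_sum (fun l _ => df ((ha' k l).mul (hdW l)) x),
      Finset.sum_congr rfl fun l _ => pd_mul (df (ha' k l) x) (df (hdW l) x), hSd, hTd]
    have : ∀ l, pd k (a k l) x = pd k (a l k) x := fun l => by rw [hsymm]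
    simp only [this]
    rw [hvρ x]
    ring
  rw [Finset.sum_congr rfl fun k _ => hXk k, Finset.sum_add_distrib, Finset.sum_add_distrib,
    ← Finset.mul_sum, ← Finset.mul_sum, hsum0, hsum1]
  ring

/-! ### Truncation functions -/

theorem hasDerivAt_max_pow (k : ℕ) (s : ℝ) :
    HasDerivAt (fun t : ℝ => (max t 0) ^ (k + 2)) ((k + 2 : ℝ) * (max s 0) ^ (k + 1)) s := by
  rcases lt_trichotomy s 0 with hs | hs | hs
  · have h1 : (fun t : ℝ => (max t 0) ^ (k + 2)) =ᶠ[nhds s] fun _ => 0 := by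
      filter_upwards [gt_mem_nhds hs] with t ht
      simp [max_eq_right (le_of_lt ht)]
    have h2 : (k + 2 : ℝ) * (max s 0) ^ (k + 1) = 0 := by simp [max_eq_right hs.le]
    rw [h2]
    exact (hasDerivAt_const s (0 : ℝ)).congr_of_eventuallyEq h1
  · subst hs
    have h2 : (k + 2 : ℝ) * (max (0 : ℝ) 0) ^ (k + 1) = 0 := by simp
    rw [h2]
    have h3 : HasFDerivAt (fun t : ℝ => (max t 0) ^ (k + 2)) (0 : ℝ →L[ℝ] ℝ) 0 := by
      apply Asymptotics.IsBigO.hasFDerivAt (n := k + 2) _ (by omega)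
      refine Asymptotics.IsBigO.of_bound 1 (Eventually.of_forall fun t => ?_)
      rw [one_mul, sub_zero, norm_pow, norm_pow, norm_norm]
      gcongr
      rw [Real.norm_eq_abs, Real.norm_eq_abs, abs_of_nonneg (le_max_right _ _)]
      exact max_le (le_abs_self t) (abs_nonneg t)
    simpa using h3.hasDerivAt
  · have h1 : (fun t : ℝ => (max t 0) ^ (k + 2)) =ᶠ[nhds s] fun t => t ^ (k + 2) := by
      filter_upwards [lt_mem_nhds hs] with t ht
      simp [max_eq_left (le_of_lt ht)]
    rw [max_eq_left hs.le]
    have := (hasDerivAt_pow (k + 2) s).congr_of_eventuallyEq h1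
    refine this.congr_deriv ?_
    push_cast
    rfl

theorem hasDerivAt_trunc_pow (n : ℝ) (k : ℕ) (s : ℝ) :
    HasDerivAt (fun t : ℝ => (max (n - t) 0) ^ (k + 2))
      (-((k + 2 : ℝ) * (max (n - s) 0) ^ (k + 1))) s := by
  have h1 : HasDerivAt (fun t : ℝ => n - t) (-1) s := by
    simpa using (hasDerivAt_id s).const_sub n
  have := (hasDerivAt_max_pow k (n - s)).comp s h1
  exact this.congr_deriv (by ring)

theorem contDiff_two_of {w w' w'' : ℝ → ℝ} (h1 : ∀ t, HasDerivAt w (w' t) t)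
    (h2 : ∀ t, HasDerivAt w' (w'' t) t) (h3 : Continuous w'') : ContDiff ℝ 2 w := by
  have e1 : deriv w = w' := funext fun t => (h1 t).deriv
  have e2 : deriv w' = w'' := funext fun t => (h2 t).deriv
  have c1 : ContDiff ℝ 1 w' := by
    rw [contDiff_one_iff_deriv]
    exact ⟨fun t => (h2 t).differentiableAt, by rwa [e2]⟩
  have : ContDiff ℝ (1 + 1) w := by
    rw [contDiff_succ_iff_deriv]
    refine ⟨fun t => (h1 t).differentiableAt, by simp, by rwa [e1]⟩
  simpa [one_add_one_eq_two] using this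

theorem fatou_dom {d : ℕ} (f g : ℕ → (Fin d → ℝ) → ℝ) (F : (Fin d → ℝ) → ℝ) (K : ℝ)
    (hf : ∀ n, Continuous (f n)) (hf0 : ∀ n x, 0 ≤ f n x) (hfg : ∀ n x, f n x ≤ g n x)
    (hg : ∀ n, Integrable (g n)) (hK : ∀ n, ∫ x, g n x ≤ K)
    (hF : ∀ x, Tendsto (fun n => f n x) atTop (nhds (F x))) : Integrable F := by
  have hK0 : ∀ n, ∫⁻ x, ENNReal.ofReal (f n x) ≤ ENNReal.ofReal K := by
    intro n
    calc ∫⁻ x, ENNReal.ofReal (f n x) ≤ ∫⁻ x, ENNReal.ofReal (g n x) :=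
          lintegral_mono fun x => ENNReal.ofReal_le_ofReal (hfg n x)
      _ = ENNReal.ofReal (∫ x, g n x) :=
          (ofReal_integral_eq_lintegral_ofReal (hg n)
            (Eventually.of_forall fun x => (hf0 n x).trans (hfg n x))).symm
      _ ≤ _ := ENNReal.ofReal_le_ofReal (hK n)
  have hFm : AEStronglyMeasurable F :=
    aestronglyMeasurable_of_tendsto_ae atTop (fun n => (hf n).aestronglyMeasurable)
      (Eventually.of_forall hF)
  have hF0 : ∀ x, 0 ≤ F x := fun x => ge_of_tendsto' (hF x) fun n => hf0 n x
  refine ⟨hFm, ?_⟩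
  rw [hasFiniteIntegral_iff_ofReal (Eventually.of_forall hF0)]
  have h1 : ∫⁻ x, ENNReal.ofReal (F x) =
      ∫⁻ x, liminf (fun n => ENNReal.ofReal (f n x)) atTop := by
    refine lintegral_congr fun x => ?_
    exact ((ENNReal.continuous_ofReal.tendsto _).comp (hF x)).liminf_eq.symm
  rw [h1]
  calc _ ≤ liminf (fun n => ∫⁻ x, ENNReal.ofReal (f n x)) atTop :=
        lintegral_liminf_le fun n => (hf n).measurable.ennreal_ofReal
    _ ≤ liminf (fun _ : ℕ => ENNReal.ofReal K) atTop :=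
        liminf_le_liminf (Eventually.of_forall hK0)
    _ = ENNReal.ofReal K := liminf_const _
    _ < ⊤ := ENNReal.ofReal_lt_top

/-! ### Quadratic functions -/

/-- The quadratic form of `P`. -/
def qf {d : ℕ} (P : Matrix (Fin d) (Fin d) ℝ) (x : Fin d → ℝ) : ℝ := x ⬝ᵥ (P *ᵥ x)

theorem contDiff_mulVec {d : ℕ} {n : WithTop ℕ∞} (P : Matrix (Fin d) (Fin d) ℝ) (k : Fin d) :
    ContDiff ℝ n (fun x : Fin d → ℝ => (P *ᵥ x) k) := by
  unfold mulVec dotProduct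
  fun_prop

theorem contDiff_qf {d : ℕ} {n : WithTop ℕ∞} (P : Matrix (Fin d) (Fin d) ℝ) :
    ContDiff ℝ n (qf P) := by
  unfold qf mulVec dotProduct
  fun_prop

theorem pd_coord {d : ℕ} (k l : Fin d) (x : Fin d → ℝ) :
    pd k (fun y : Fin d → ℝ => y l) x = if l = k then 1 else 0 := by
  unfold pd
  rw [fderiv_apply (by fun_prop)]
  simp [Pi.single_apply]

theorem pd_mulVec {d : ℕ} (P : Matrix (Fin d) (Fin d) ℝ) (k l : Fin d) (x : Fin d → ℝ) :
    pd k (fun y => (P *ᵥ y) l) x = P l k := by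
  unfold mulVec dotProduct
  rw [pd_sum (fun i _ => by fun_prop)]
  rw [Finset.sum_congr rfl fun i _ => pd_const_mul (P l i) (by fun_prop)]
  simp [pd_coord]

theorem pd_qf {d : ℕ} (P : Matrix (Fin d) (Fin d) ℝ) (hP : Pᵀ = P) (k : Fin d)
    (x : Fin d → ℝ) : pd k (qf P) x = 2 * (P *ᵥ x) k := by
  unfold qf
  have hd : ∀ i, DifferentiableAt ℝ (fun y => (P *ᵥ y) i) x := fun i =>
    ((contDiff_mulVec (n := 1) P i).differentiable (by norm_num)).differentiableAt
  have h1 : (fun y : Fin d → ℝ => y ⬝ᵥ (P *ᵥ y)) = fun y => ∑ i, y i * (P *ᵥ y) i := rfl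
  rw [h1, pd_sum (fun i _ => DifferentiableAt.fun_mul (by fun_prop) (hd i))]
  rw [Finset.sum_congr rfl fun i _ => pd_mul (by fun_prop) (hd i)]
  simp only [pd_coord, pd_mulVec, Finset.sum_add_distrib]
  have h2 : ∑ i, x i * P i k = (P *ᵥ x) k := by
    simp only [mulVec, dotProduct]
    refine Finset.sum_congr rfl fun i _ => ?_
    rw [← hP, Matrix.transpose_apply, hP]; ring
  rw [h2]
  simp; ring

theorem gen_comp {d : ℕ} (P : Matrix (Fin d) (Fin d) ℝ) (hP : Pᵀ = P) {w w' w'' : ℝ → ℝ}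
    (h1 : ∀ t, HasDerivAt w (w' t) t) (h2 : ∀ t, HasDerivAt w' (w'' t) t) (x : Fin d → ℝ) :
    (∀ k, pd k (fun y => w (qf P y)) x = w' (qf P x) * (2 * (P *ᵥ x) k)) ∧
    (∀ k l, pd k (pd l (fun y => w (qf P y))) x =
      w'' (qf P x) * (4 * ((P *ᵥ x) k * (P *ᵥ x) l)) + w' (qf P x) * (2 * P l k)) := by
  have hq : ∀ y, DifferentiableAt ℝ (qf P) y := fun y =>
    ((contDiff_qf (n := 1) P).differentiable (by norm_num)).differentiableAt
  have hm : ∀ i, DifferentiableAt ℝ (fun y => (P *ᵥ y) i) x := fun i =>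
    ((contDiff_mulVec (n := 1) P i).differentiable (by norm_num)).differentiableAt
  have e1 : ∀ y k, pd k (fun y => w (qf P y)) y = w' (qf P y) * (2 * (P *ᵥ y) k) := by
    intro y k
    rw [pd_comp (h1 _) (hq y), pd_qf P hP]
  refine ⟨e1 x, fun k l => ?_⟩
  have e2 : pd l (fun y => w (qf P y)) = fun y => w' (qf P y) * (2 * (P *ᵥ y) l) :=
    funext fun y => e1 y l
  have hd2 : DifferentiableAt ℝ (fun y => w' (qf P y)) x :=
    (h2 (qf P x)).differentiableAt.fun_comp' x (hq x)
  rw [e2, pd_mul hd2 ((hm l).const_mul 2), pd_comp (h2 _) (hq x), pd_qf P hP,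
    pd_const_mul 2 (hm l), pd_mulVec]
  ring

theorem hasCompactSupport_qf {d : ℕ} (P : Matrix (Fin d) (Fin d) ℝ)
    (hP1 : ∀ x : Fin d → ℝ, x ⬝ᵥ x ≤ x ⬝ᵥ (P *ᵥ x)) (n : ℝ) :
    IsCompact {x | qf P x ≤ n} := by
  apply Metric.isCompact_of_isClosed_isBounded
  · exact isClosed_le (contDiff_qf (n := 0) P).continuous continuous_const
  · apply (Metric.isBounded_closedBall (x := (0 : Fin d → ℝ)) (r := n + 1)).subset
    intro x hx
    have hx' : x ⬝ᵥ (P *ᵥ x) ≤ n := hx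
    have h0 := dot_self_nonneg x
    rw [mem_closedBall_zero_iff, pi_norm_le_iff_of_nonneg (by linarith [hP1 x])]
    intro i
    have h3 : x i * x i ≤ x ⬝ᵥ x :=
      Finset.single_le_sum (f := fun i => x i * x i) (fun _ _ => mul_self_nonneg _)
        (Finset.mem_univ i)
    have h4 := hP1 x
    rw [Real.norm_eq_abs]
    nlinarith [abs_nonneg (x i), abs_mul_abs_self (x i)]

/-! ### Scalar estimates -/

theorem moment_scalar {c r D n V β τ Γ u : ℝ} (hr : 0 < r) (hcD : c * D ≤ r / 2) (hc : 0 < c)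
    (hV : 0 ≤ V) (hn : 1 ≤ n) (hβ : β ≤ -(2 * r) * V) (hτ : |τ| ≤ D * (1 + V))
    (hΓ0 : 0 ≤ Γ) (hΓ : Γ ≤ D * (1 + V) * V) (hu : u = max (n - V) 0) :
    (u / n) ^ 2 * V ^ 2 ≤ 1 + 2 / (r * n ^ 2) *
      ((-(n * u ^ 2) + u ^ 3) * (β + c * τ) + c * (2 * n * u - 3 * u ^ 2) * Γ) := by
  have hn0 : 0 < n := by linarith
  have hτ1 : c * τ ≤ r / 2 * (1 + V) := by
    have h1 : τ ≤ D * (1 + V) := (le_abs_self _).trans hτ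
    have h2 : c * τ ≤ c * (D * (1 + V)) := mul_le_mul_of_nonneg_left h1 hc.le
    have h3 : c * D * (1 + V) ≤ r / 2 * (1 + V) := mul_le_mul_of_nonneg_right hcD (by linarith)
    linarith
  have hΓ1 : c * Γ ≤ r / 2 * ((1 + V) * V) := by
    have h2 : c * Γ ≤ c * (D * (1 + V) * V) := mul_le_mul_of_nonneg_left hΓ hc.le
    have h3 : c * D * ((1 + V) * V) ≤ r / 2 * ((1 + V) * V) :=
      mul_le_mul_of_nonneg_right hcD (by positivity)
    linarith
  have hkey : r / 2 * V ^ 2 - r / 2 ≤ V * (-(β + c * τ)) - c * Γ := by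
    have h1 : V * (3 / 2 * r * V - r / 2) ≤ V * (-(β + c * τ)) :=
      mul_le_mul_of_nonneg_left (by linarith) hV
    nlinarith [mul_nonneg hr.le (sq_nonneg (V - 1))]
  rcases le_total (n - V) 0 with h | h
  · rw [max_eq_right h] at hu
    subst hu
    norm_num
  · rw [max_eq_left h] at hu
    have hun : u ≤ n := by linarith
    have hu0 : 0 ≤ u := by linarith
    set E := (-(n * u ^ 2) + u ^ 3) * (β + c * τ) + c * (2 * n * u - 3 * u ^ 2) * Γ with hE
    have hE2 : u ^ 2 * (r / 2 * V ^ 2 - r / 2) ≤ E := by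
      have h1 : E = u ^ 2 * (V * (-(β + c * τ)) - c * Γ) + 2 * u * V * (c * Γ) := by
        have : n = u + V := by linarith
        rw [hE, this]; ring
      rw [h1]
      have h2 := mul_le_mul_of_nonneg_left hkey (sq_nonneg u)
      have h3 : 0 ≤ 2 * u * V * (c * Γ) := by positivity
      linarith
    have h4 : 2 / (r * n ^ 2) * (u ^ 2 * (r / 2 * V ^ 2 - r / 2)) ≤ 2 / (r * n ^ 2) * E :=
      mul_le_mul_of_nonneg_left hE2 (by positivity)
    have h5 : 2 / (r * n ^ 2) * (u ^ 2 * (r / 2 * V ^ 2 - r / 2)) =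
        (u / n) ^ 2 * V ^ 2 - (u / n) ^ 2 := by
      field_simp
    have h6 : (u / n) ^ 2 ≤ 1 := by
      apply pow_le_one₀ (by positivity)
      rw [div_le_one hn0]; exact hun
    linarith

theorem trunc_facts {c r D n V β τ Γ u : ℝ} (hr : 0 < r) (hD : 0 < D) (hcD : c * D ≤ r / 2)
    (hc : 0 < c) (hV : 0 ≤ V) (hn : 1 ≤ n) (hβ : β ≤ -(2 * r) * V) (hβ' : |β| ≤ D * V)
    (hτ : |τ| ≤ D * (1 + V))
    (hΓ0 : 0 ≤ Γ) (hΓ : Γ ≤ D * (1 + V) * V) (hu : u = max (n - V) 0) :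
    0 ≤ V * u ^ 3 / n ^ 3 ∧ V * u ^ 3 / n ^ 3 ≤ V ∧ |(u ^ 3 - 3 * V * u ^ 2) / n ^ 3| ≤ 4 ∧
    (u / n) ^ 3 * (r * V - r) - (3 * D + 9 * r) * (1 + V) ^ 2 / n ≤
      -((u ^ 3 - 3 * V * u ^ 2) / n ^ 3 * (β + c * τ) +
        c * ((-6 * u ^ 2 + 6 * V * u) / n ^ 3) * Γ) := by
  have hn0 : 0 < n := by linarith
  have hcτ : c * |τ| ≤ r / 2 * (1 + V) := by
    have h2 : c * |τ| ≤ c * (D * (1 + V)) := mul_le_mul_of_nonneg_left hτ hc.le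
    have h3 : c * D * (1 + V) ≤ r / 2 * (1 + V) := mul_le_mul_of_nonneg_right hcD (by linarith)
    linarith
  have hΓ1 : c * Γ ≤ r / 2 * ((1 + V) * V) := by
    have h2 : c * Γ ≤ c * (D * (1 + V) * V) := mul_le_mul_of_nonneg_left hΓ hc.le
    have h3 : c * D * ((1 + V) * V) ≤ r / 2 * ((1 + V) * V) :=
      mul_le_mul_of_nonneg_right hcD (by positivity)
    linarith
  rcases le_total (n - V) 0 with h | h
  · rw [max_eq_right h] at hu
    subst hu
    norm_num
    exact ⟨hV, by positivity⟩
  rw [max_eq_left h] at hu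
  have hun : u ≤ n := by linarith
  have hu0 : 0 ≤ u := by linarith
  set θ := u / n with hθ
  set z := V / n with hz
  have hθ0 : 0 ≤ θ := by positivity
  have hθ1 : θ ≤ 1 := by rw [hθ, div_le_one hn0]; exact hun
  have hz0 : 0 ≤ z := by positivity
  have hz1 : z ≤ 1 := by rw [hz, div_le_one hn0]; linarith
  have hun' : u = θ * n := by rw [hθ]; field_simp
  have hθ3 : θ ^ 3 ≤ 1 := pow_le_one₀ hθ0 hθ1
  have hθ2 : θ ^ 2 ≤ 1 := pow_le_one₀ hθ0 hθ1
  have e1 : V * u ^ 3 / n ^ 3 = V * θ ^ 3 := by rw [hθ]; field_simp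
  have e2 : (u ^ 3 - 3 * V * u ^ 2) / n ^ 3 = θ ^ 3 - 3 * z * θ ^ 2 := by
    rw [hθ, hz]; field_simp
  have e3 : (-6 * u ^ 2 + 6 * V * u) / n ^ 3 = (-6 * θ ^ 2 + 6 * z * θ) / n := by
    rw [hθ, hz]; field_simp
  rw [e1, e2, e3]
  refine ⟨by positivity, mul_le_of_le_one_right hV hθ3, ?_, ?_⟩
  · have h3 : z * θ ^ 2 ≤ 1 := mul_le_one₀ hz1 (by positivity) hθ2
    have h4 : 0 ≤ z * θ ^ 2 := by positivity
    have h5 : 0 ≤ θ ^ 3 := by positivity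
    rw [abs_le]; constructor <;> linarith
  · have a1 := abs_le.1 (le_refl |τ|)
    have hct : |c * τ| ≤ r / 2 * (1 + V) := by rwa [abs_mul, abs_of_pos hc]
    have b1 := abs_le.1 hct
    have b2 := abs_le.1 hβ'
    have L1 : r * V - r ≤ -(β + c * τ) := by
      have : 0 ≤ r * V := by positivity
      linarith [b1.2]
    have L2 : -((D + r) * (1 + V)) ≤ β + c * τ := by
      have : 0 ≤ r * (1 + V) := by positivity
      linarith [b1.1, b2.1]
    have t1 : θ ^ 3 * (r * V - r) ≤ θ ^ 3 * (-(β + c * τ)) :=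
      mul_le_mul_of_nonneg_left L1 (by positivity)
    have t2 : -(3 * (D + r) * (1 + V) ^ 2 / n) ≤ 3 * z * θ ^ 2 * (β + c * τ) := by
      have h1 : 3 * z * θ ^ 2 * (-((D + r) * (1 + V))) ≤ 3 * z * θ ^ 2 * (β + c * τ) :=
        mul_le_mul_of_nonneg_left L2 (by positivity)
      have h2 : z * θ ^ 2 ≤ (1 + V) / n := by
        calc z * θ ^ 2 ≤ z := mul_le_of_le_one_right hz0 hθ2
          _ ≤ _ := by rw [hz]; gcongr; linarith
      have h3 : z * θ ^ 2 * (3 * ((D + r) * (1 + V))) ≤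
          (1 + V) / n * (3 * ((D + r) * (1 + V))) :=
        mul_le_mul_of_nonneg_right h2 (by positivity)
      have h4 : (1 + V) / n * (3 * ((D + r) * (1 + V))) = 3 * (D + r) * (1 + V) ^ 2 / n := by
        ring
      linarith
    have t3 : c * ((-6 * θ ^ 2 + 6 * z * θ) / n) * Γ ≤ 6 * r * (1 + V) ^ 2 / n := by
      have h1 : -6 * θ ^ 2 + 6 * z * θ ≤ 6 := by
        have : z * θ ≤ 1 := mul_le_one₀ hz1 hθ0 hθ1
        nlinarith [sq_nonneg θ]
      have h2 : c * ((-6 * θ ^ 2 + 6 * z * θ) / n) * Γ =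
        (-6 * θ ^ 2 + 6 * z * θ) * (c * Γ) / n := by ring
      rw [h2]
      apply div_le_div_of_nonneg_right _ hn0.le
      have h3 : (-6 * θ ^ 2 + 6 * z * θ) * (c * Γ) ≤ 6 * (c * Γ) :=
        mul_le_mul_of_nonneg_right h1 (by positivity)
      have h4 : 0 ≤ r * (1 + V) := by positivity
      have h5 : 0 ≤ r * (1 + V) * V := by positivity
      nlinarith
    have e4 : (3 * D + 9 * r) * (1 + V) ^ 2 / n =
      3 * (D + r) * (1 + V) ^ 2 / n + 6 * r * (1 + V) ^ 2 / n := by ring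
    rw [e4]
    linarith

theorem grad_scalar {d : ℕ} {c κ p0 v h2 Q : ℝ} (H ξ : Fin d → ℝ) (hc : 0 < c) (hκ : 0 < κ)
    (hp : 0 < p0) (hQ : κ * (ξ ⬝ᵥ ξ) ≤ Q) (hH : H ⬝ᵥ H ≤ h2) :
    -(v * p0 * v * h2 / (4 * c * κ)) ≤ c * p0 * Q - v * p0 * ∑ k, H k * ξ k := by
  have h1 : c * p0 * (κ * (ξ ⬝ᵥ ξ)) ≤ c * p0 * Q := mul_le_mul_of_nonneg_left hQ (by positivity)
  have h3 : v * p0 * v * (H ⬝ᵥ H) / (4 * c * κ) ≤ v * p0 * v * h2 / (4 * c * κ) := by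
    apply div_le_div_of_nonneg_right _ (by positivity)
    apply mul_le_mul_of_nonneg_left hH
    nlinarith [mul_nonneg hp.le (mul_self_nonneg v)]
  have h4 : 0 ≤ c * p0 * (κ * (ξ ⬝ᵥ ξ)) - v * p0 * ∑ k, H k * ξ k +
      v * p0 * v * (H ⬝ᵥ H) / (4 * c * κ) := by
    have : c * p0 * (κ * (ξ ⬝ᵥ ξ)) - v * p0 * ∑ k, H k * ξ k +
      v * p0 * v * (H ⬝ᵥ H) / (4 * c * κ) =
      ∑ k, p0 * (c * κ) * (ξ k - v * H k / (2 * c * κ)) ^ 2 := by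
      simp only [dotProduct, Finset.mul_sum, Finset.sum_div, ← Finset.sum_sub_distrib,
        ← Finset.sum_add_distrib]
      refine Finset.sum_congr rfl fun k _ => ?_
      field_simp
      ring
    rw [this]
    exact Finset.sum_nonneg fun k _ => by positivity
  linarith

theorem gen_split {d : ℕ} (a : Fin d → Fin d → ℝ) (P : Matrix (Fin d) (Fin d) ℝ) (b p : Fin d → ℝ) (c w' w'' : ℝ) :
    ∑ k, b k * (w' * (2 * p k)) +
      c * ∑ k, ∑ l, a k l * (w'' * (4 * (p k * p l)) + w' * (2 * P l k)) =
    w' * (∑ k, b k * (2 * p k) + c * ∑ k, ∑ l, a k l * (2 * P l k)) +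
      c * w'' * ∑ k, ∑ l, a k l * (4 * (p k * p l)) := by
  have h1 : ∑ k, b k * (w' * (2 * p k)) = w' * ∑ k, b k * (2 * p k) := by
    rw [Finset.mul_sum]; exact Finset.sum_congr rfl fun k _ => by ring
  have h2 : ∑ k, ∑ l, a k l * (w'' * (4 * (p k * p l)) + w' * (2 * P l k)) =
      w'' * ∑ k, ∑ l, a k l * (4 * (p k * p l)) + w' * ∑ k, ∑ l, a k l * (2 * P l k) := by
    simp only [Finset.mul_sum, ← Finset.sum_add_distrib]
    exact Finset.sum_congr rfl fun k _ => Finset.sum_congr rfl fun l _ => by ring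
  rw [h1, h2]; ring

/-! ### Moment bound -/

/-- The structural bounds for the Lyapunov function `qf P`. -/
structure LyapBounds {d : ℕ} (c r D : ℝ) (a : Fin d → Fin d → (Fin d → ℝ) → ℝ)
    (b : Fin d → (Fin d → ℝ) → ℝ) (P : Matrix (Fin d) (Fin d) ℝ) : Prop where
  hr : 0 < r
  hc : 0 < c
  hD : 0 < D
  hcD : c * D ≤ r / 2
  ha : ∀ k l, ContDiff ℝ 2 (a k l)
  hsymm : ∀ k l, a k l = a l k
  hb : ∀ k, ContDiff ℝ 1 (b k)
  hP : Pᵀ = P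
  hP1 : ∀ x : Fin d → ℝ, x ⬝ᵥ x ≤ x ⬝ᵥ (P *ᵥ x)
  hβ : ∀ x, ∑ k, b k x * (2 * (P *ᵥ x) k) ≤ -(2 * r) * qf P x
  hβ' : ∀ x, |∑ k, b k x * (2 * (P *ᵥ x) k)| ≤ D * qf P x
  hτ : ∀ x, |∑ k, ∑ l, a k l x * (2 * P l k)| ≤ D * (1 + qf P x)
  hΓ0 : ∀ x, 0 ≤ ∑ k, ∑ l, a k l x * (4 * ((P *ᵥ x) k * (P *ᵥ x) l))
  hΓ : ∀ x, ∑ k, ∑ l, a k l x * (4 * ((P *ᵥ x) k * (P *ᵥ x) l)) ≤ D * (1 + qf P x) * qf P x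

theorem LyapBounds.hV {d : ℕ} {c r D : ℝ} {a : Fin d → Fin d → (Fin d → ℝ) → ℝ}
    {b : Fin d → (Fin d → ℝ) → ℝ} {P : Matrix (Fin d) (Fin d) ℝ}
    (h : LyapBounds c r D a b P) (x : Fin d → ℝ) : 0 ≤ qf P x :=
  (dot_self_nonneg x).trans (h.hP1 x)

theorem compact_comp {d : ℕ} (P : Matrix (Fin d) (Fin d) ℝ)
    (hP1 : ∀ x : Fin d → ℝ, x ⬝ᵥ x ≤ x ⬝ᵥ (P *ᵥ x)) (w : ℝ → ℝ) (n : ℝ)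
    (hw : ∀ t, n ≤ t → w t = 0) : HasCompactSupport (fun x => w (qf P x)) :=
  HasCompactSupport.intro (hasCompactSupport_qf P hP1 n) fun x hx => by
    simp only [Set.mem_ofPred_eq, not_le] at hx
    exact hw _ hx.le

theorem trunc_tendsto (V : ℝ) :
    Tendsto (fun n : ℕ => max ((n + 1 : ℝ) - V) 0 / (n + 1 : ℝ)) atTop (nhds 1) := by
  have h1 : Tendsto (fun n : ℕ => V * (1 / ((n : ℝ) + 1))) atTop (nhds (V * 0)) :=
    tendsto_one_div_add_atTop_nhds_zero_nat.const_mul V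
  have h2 : Tendsto (fun n : ℕ => 1 - V * (1 / ((n : ℝ) + 1))) atTop (nhds (1 - V * 0)) :=
    h1.const_sub 1
  have h3 : Tendsto (fun n : ℕ => max (1 - V * (1 / ((n : ℝ) + 1))) 0) atTop
      (nhds (max (1 - V * 0) 0)) := h2.max tendsto_const_nhds
  have h4 : max (1 - V * 0) 0 = 1 := by norm_num
  rw [h4] at h3
  refine h3.congr fun n => ?_
  have hn : (0 : ℝ) < (n : ℝ) + 1 := by positivity
  rw [← max_div_div_right hn.le]
  congr 1
  · field_simp
  · simp

theorem moment_bound {d : ℕ} {c r D : ℝ} {a : Fin d → Fin d → (Fin d → ℝ) → ℝ}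
    {b : Fin d → (Fin d → ℝ) → ℝ} {P : Matrix (Fin d) (Fin d) ℝ}
    (H : LyapBounds c r D a b P) (ρ : (Fin d → ℝ) → ℝ) (hρ : ContDiff ℝ 2 ρ)
    (hρ0 : ∀ x, 0 < ρ x) (hρi : Integrable ρ)
    (hFP : ∀ x, (0 : ℝ) = -(∑ k, pd k (fun y => b k y * ρ y) x) +
        c * ∑ k, ∑ l, pd k (pd l (fun y => a k l y * ρ y)) x) :
    Integrable (fun x => ρ x * qf P x ^ 2) := by
  have hr := H.hr

  have key : ∀ n : ℕ, ∃ E : (Fin d → ℝ) → ℝ, Integrable E ∧ ∫ x, E x = 0 ∧ ∀ x,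
      ρ x * ((max ((n + 1 : ℝ) - qf P x) 0 / (n + 1 : ℝ)) ^ 2 * qf P x ^ 2) ≤ ρ x + E x := by
    intro n
    obtain ⟨N, hN⟩ : ∃ N : ℝ, N = (n : ℝ) + 1 := ⟨_, rfl⟩
    have hN1 : 1 ≤ N := by rw [hN]; linarith [(Nat.cast_nonneg n : (0 : ℝ) ≤ n)]
    rw [← hN]
    let w : ℝ → ℝ := fun t => N / 3 * max (N - t) 0 ^ 3 - 1 / 4 * max (N - t) 0 ^ 4
    let w' : ℝ → ℝ := fun t => -(N * max (N - t) 0 ^ 2) + max (N - t) 0 ^ 3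
    let w'' : ℝ → ℝ := fun t => 2 * N * max (N - t) 0 - 3 * max (N - t) 0 ^ 2
    have h1 : ∀ t, HasDerivAt w (w' t) t := fun t =>
      (((hasDerivAt_trunc_pow N 1 t).const_mul (N / 3)).sub
        ((hasDerivAt_trunc_pow N 2 t).const_mul (1 / 4))).congr_deriv
        (by simp only [w']; push_cast; ring)
    have h2 : ∀ t, HasDerivAt w' (w'' t) t := fun t =>
      ((((hasDerivAt_trunc_pow N 0 t).const_mul N).neg).add
        (hasDerivAt_trunc_pow N 1 t)).congr_deriv
        (by simp only [w'']; push_cast; ring)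
    have h3 : Continuous w'' := by simp only [w'']; fun_prop
    have hw2 : ContDiff ℝ 2 w := contDiff_two_of h1 h2 h3
    have hW2 : ContDiff ℝ 2 (fun x => w (qf P x)) := hw2.comp (contDiff_qf P)
    have hWc : HasCompactSupport (fun x => w (qf P x)) :=
      compact_comp P H.hP1 w N fun t ht => by
        simp only [w]; rw [max_eq_right (by linarith)]; simp
    obtain ⟨E, hE1, hE2, hE3⟩ := int_identity c a H.ha H.hsymm b b H.hb H.hb ρ ρ (fun _ => 1)
      hρ hρ contDiff_const (fun x => by simp) hFP hFP (fun _ => 1) (fun _ => 0) (fun _ => 0)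
      contDiff_const contDiff_const (fun k x => by simp [pd]) (fun k x => by simp [pd])
      _ hW2 hWc
    refine ⟨fun x => -(2 / (r * N ^ 2)) * E x, hE1.const_mul _, ?_, fun x => ?_⟩
    · rw [integral_const_mul, hE2, mul_zero]
    · have hg := gen_comp P H.hP h1 h2 x
      have hs := moment_scalar (u := max (N - qf P x) 0) hr H.hcD H.hc (H.hV x) hN1 (H.hβ x)
        (H.hτ x) (H.hΓ0 x) (H.hΓ x) rfl
      have hx := hE3 x
      simp only [hg.1, hg.2] at hx
      rw [gen_split (fun k l => a k l x) P (fun k => b k x) (P *ᵥ x)] at hx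
      have hx' : E x = -(ρ x * (w' (qf P x) * (∑ k, b k x * (2 * (P *ᵥ x) k) +
          c * ∑ k, ∑ l, a k l x * (2 * P l k)) +
          c * w'' (qf P x) * ∑ k, ∑ l, a k l x * (4 * ((P *ᵥ x) k * (P *ᵥ x) l)))) := by
        rw [hx]; ring
      beta_reduce
      rw [hx']
      have := mul_le_mul_of_nonneg_left hs (hρ0 x).le
      simp only [w', w'']
      linarith
  choose E hE1 hE2 hE3 using key
  refine fatou_dom
    (fun n x => ρ x * ((max ((n + 1 : ℝ) - qf P x) 0 / (n + 1 : ℝ)) ^ 2 * qf P x ^ 2))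
    (fun n x => ρ x + E n x) _ (∫ x, ρ x) ?_ ?_ hE3 (fun n => hρi.add (hE1 n)) ?_ ?_
  · intro n
    have hq : Continuous (qf P) := (contDiff_qf (n := 0) P).continuous
    have := hρ.continuous
    fun_prop
  · intro n x
    have := (hρ0 x).le
    positivity
  · intro n
    rw [integral_add hρi (hE1 n), hE2, add_zero]
  · intro x
    have := (((trunc_tendsto (qf P x)).pow 2).mul_const (qf P x ^ 2)).const_mul (ρ x)
    simpa using this

/-! ### Entropy bound -/

/-- Truncated logarithm. -/
noncomputable def tl (δ v : ℝ) : ℝ := Real.log (1 + v) - Real.log (1 + δ * v)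

/-- Derivative of the truncated logarithm. -/
noncomputable def tl' (δ v : ℝ) : ℝ := (1 - δ) / ((1 + v) * (1 + δ * v))

/-- Second derivative of `v * tl δ v`. -/
noncomputable def tq (δ v : ℝ) : ℝ :=
  (1 - δ) * (2 + (1 + δ) * v) / ((1 + v) ^ 2 * (1 + δ * v) ^ 2)

theorem hasDerivAt_tl {δ v : ℝ} (hδ : 0 < δ) (hv : 0 < v) : HasDerivAt (tl δ) (tl' δ v) v := by
  have e1 : 1 + v ≠ 0 := by positivity
  have e2 : 1 + δ * v ≠ 0 := by positivity
  have h1 : HasDerivAt (fun y => 1 + y) 1 v := (hasDerivAt_id v).const_add 1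
  have h2 : HasDerivAt (fun y => 1 + δ * y) (δ * 1) v :=
    ((hasDerivAt_id v).const_mul δ).const_add 1
  refine ((h1.log e1).sub (h2.log e2)).congr_deriv ?_
  unfold tl'
  field_simp
  ring

theorem hasDerivAt_tl' {δ v : ℝ} (hδ : 0 < δ) (hv : 0 < v) : HasDerivAt (tl' δ)
    (-((1 - δ) * (1 + δ + 2 * δ * v)) / ((1 + v) * (1 + δ * v)) ^ 2) v := by
  have e1 : 1 + v ≠ 0 := by positivity
  have e2 : 1 + δ * v ≠ 0 := by positivity
  have h1 : HasDerivAt (fun y => 1 + y) 1 v := (hasDerivAt_id v).const_add 1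
  have h2 : HasDerivAt (fun y => 1 + δ * y) (δ * 1) v :=
    ((hasDerivAt_id v).const_mul δ).const_add 1
  refine ((hasDerivAt_const v (1 - δ)).fun_div (h1.fun_mul h2) (mul_ne_zero e1 e2)).congr_deriv ?_
  congr 1
  ring

theorem hasDerivAt_tS {δ v : ℝ} (hδ : 0 < δ) (hv : 0 < v) :
    HasDerivAt (fun y => tl δ y + y * tl' δ y) (tq δ v) v := by
  have e1 : 1 + v ≠ 0 := by positivity
  have e2 : 1 + δ * v ≠ 0 := by positivity
  refine ((hasDerivAt_tl hδ hv).add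
    ((hasDerivAt_id v).fun_mul (hasDerivAt_tl' hδ hv))).congr_deriv ?_
  unfold tl' tq
  simp only [id]
  field_simp
  ring

theorem hasDerivAt_tT {δ v : ℝ} (hδ : 0 < δ) (hv : 0 < v) :
    HasDerivAt (fun y => -(y ^ 2 * tl' δ y)) (-(v * tq δ v)) v := by
  have e1 : 1 + v ≠ 0 := by positivity
  have e2 : 1 + δ * v ≠ 0 := by positivity
  refine (((hasDerivAt_pow 2 v).fun_mul (hasDerivAt_tl' hδ hv)).neg).congr_deriv ?_
  unfold tl' tq
  push_cast
  field_simp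
  ring

theorem tl_facts {δ v : ℝ} (hδ : 0 < δ) (hδ1 : δ ≤ 1) (hv : 0 < v) :
    0 ≤ tq δ v ∧ v * tq δ v ≤ 2 ∧ 0 ≤ tl δ v ∧ tl δ v ≤ Real.log (1 + v) ∧ tl δ v ≤ 1 / δ ∧
    0 ≤ v * tl' δ v ∧ v * tl' δ v ≤ 1 := by
  have hδ' : 0 ≤ 1 - δ := by linarith
  have hδv : 0 < δ * v := by positivity
  refine ⟨by unfold tq; positivity, ?_, ?_, ?_, ?_, by unfold tl'; positivity, ?_⟩
  · unfold tq
    rw [← mul_div_assoc, div_le_iff₀ (by positivity)]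
    have h1 : 1 ≤ (1 + δ * v) ^ 2 := one_le_pow₀ (by linarith)
    have h2 : (1 + v) ^ 2 ≤ (1 + v) ^ 2 * (1 + δ * v) ^ 2 :=
      le_mul_of_one_le_right (by positivity) h1
    have h3 : v * ((1 - δ) * (2 + (1 + δ) * v)) ≤ v * (1 * (2 + 2 * v)) := by
      gcongr <;> linarith
    nlinarith
  · unfold tl
    have : Real.log (1 + δ * v) ≤ Real.log (1 + v) :=
      Real.log_le_log (by positivity) (by nlinarith)
    linarith
  · unfold tl
    have : 0 ≤ Real.log (1 + δ * v) := Real.log_nonneg (by linarith)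
    linarith
  · unfold tl
    have h1 : Real.log (1 + v) ≤ Real.log (1 / δ * (1 + δ * v)) := by
      apply Real.log_le_log (by positivity)
      have : 1 / δ * (1 + δ * v) = 1 / δ + v := by field_simp
      rw [this]
      have : 1 ≤ 1 / δ := by rw [le_div_iff₀ hδ]; linarith
      linarith
    rw [Real.log_mul (by positivity) (by positivity)] at h1
    have h2 := Real.log_le_self (show 0 ≤ 1 / δ by positivity)
    linarith
  · unfold tl'
    rw [← mul_div_assoc, div_le_one (by positivity)]
    nlinarith [mul_pos hδv hv]

theorem entropy_scalar {p0 p1 v W q X T S LW HW l Lg θ V K1 N D c κ r ind : ℝ}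
    (hp0 : 0 < p0) (hv : 0 < v) (hp1 : p1 = v * p0) (hW0 : 0 ≤ W) (hWV : W ≤ V) (hq : 0 ≤ q)
    (hvq : v * q ≤ 2) (hc : 0 < c) (hκ : 0 < κ) (hD : 0 < D) (hr : 0 < r) (hN : 1 ≤ N)
    (hK1 : 0 ≤ K1)
    (hX : -(v * p0 * v * (D * V) / (4 * c * κ)) ≤ X) (hΨ : p0 * T + p1 * S = p1 * l)
    (hT : |p0 * T| ≤ p1) (hLW : θ * (r * V - r) - K1 * (1 + V) ^ 2 / N ≤ -LW)
    (hHW : |HW| ≤ 4 * (D * V)) (hl0 : 0 ≤ l) (hlN : l ≤ N) (hlL : l ≤ Lg) (hθ0 : 0 ≤ θ)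
    (hθ1 : θ ≤ 1) (hi0 : 0 ≤ ind) (hi : V ≤ 2 → ind = 1) :
    p1 * (r * l * θ) ≤ W * q * X - (p0 * T + p1 * S) * LW + p0 * T * HW +
      p1 * ((D / (2 * c * κ) + K1 + 4 * D) * (1 + V) ^ 2) + 2 * r * (ind * (p1 * Lg)) := by
  have hV : 0 ≤ V := hW0.trans hWV
  have hp1' : 0 < p1 := by rw [hp1]; positivity
  have A1 : -(p1 * (D / (2 * c * κ) * (1 + V) ^ 2)) ≤ W * q * X := by
    have h1 : W * q * (-(v * p0 * v * (D * V) / (4 * c * κ))) ≤ W * q * X :=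
      mul_le_mul_of_nonneg_left hX (by positivity)
    have h2 : W * (v * q) ≤ V * 2 := mul_le_mul hWV hvq (by positivity) hV
    have h3 : W * (v * q) * (p1 * (D * V) / (4 * c * κ)) ≤ V * 2 * (p1 * (D * V) / (4 * c * κ)) :=
      mul_le_mul_of_nonneg_right h2 (by positivity)
    have h4 : V * 2 * (p1 * (D * V) / (4 * c * κ)) = p1 * (D / (2 * c * κ)) * V ^ 2 := by
      field_simp; ring
    have h5 : p1 * (D / (2 * c * κ)) * V ^ 2 ≤ p1 * (D / (2 * c * κ)) * (1 + V) ^ 2 := by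
      gcongr; linarith
    have h6 : W * q * (-(v * p0 * v * (D * V) / (4 * c * κ))) =
      -(W * (v * q) * (p1 * (D * V) / (4 * c * κ))) := by rw [hp1]; ring
    linarith
  have A2 : p1 * l * (θ * (r * V - r)) - p1 * (K1 * (1 + V) ^ 2) ≤ -((p0 * T + p1 * S) * LW) := by
    rw [hΨ]
    have h1 : p1 * l * (θ * (r * V - r) - K1 * (1 + V) ^ 2 / N) ≤ p1 * l * (-LW) :=
      mul_le_mul_of_nonneg_left hLW (by positivity)
    have h2 : l / N ≤ 1 := by rw [div_le_one (by linarith)]; exact hlN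
    have h3 : p1 * (K1 * (1 + V) ^ 2) * (l / N) ≤ p1 * (K1 * (1 + V) ^ 2) :=
      mul_le_of_le_one_right (by positivity) h2
    have h4 : p1 * l * (θ * (r * V - r) - K1 * (1 + V) ^ 2 / N) =
      p1 * l * (θ * (r * V - r)) - p1 * (K1 * (1 + V) ^ 2) * (l / N) := by ring
    linarith
  have A3 : -(p1 * (4 * D * (1 + V) ^ 2)) ≤ p0 * T * HW := by
    have h1 : |p0 * T * HW| ≤ p1 * (4 * (D * V)) := by
      rw [abs_mul]; exact mul_le_mul hT hHW (abs_nonneg _) hp1'.le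
    have h2 : p1 * (4 * (D * V)) ≤ p1 * (4 * D * (1 + V) ^ 2) := by
      apply mul_le_mul_of_nonneg_left _ hp1'.le
      nlinarith [mul_nonneg hD.le hV, mul_nonneg hD.le (sq_nonneg V)]
    linarith [(abs_le.1 h1).1]
  have A4 : p1 * (r * l * θ) - 2 * r * (ind * (p1 * Lg)) ≤ p1 * l * (θ * (r * V - r)) := by
    rcases le_or_gt V 2 with h | h
    · rw [hi h]
      have h1 : l * θ ≤ Lg := (mul_le_of_le_one_right hl0 hθ1).trans hlL
      have h2 : p1 * r * (l * θ) ≤ p1 * r * Lg := mul_le_mul_of_nonneg_left h1 (by positivity)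
      have h3 : 0 ≤ p1 * l * θ * r * V := by positivity
      nlinarith
    · have h1 : 0 ≤ 2 * r * (ind * (p1 * Lg)) := by
        have : 0 ≤ Lg := hl0.trans hlL
        positivity
      have h2 : 0 ≤ p1 * l * θ * r * (V - 2) := by
        have : 0 ≤ V - 2 := by linarith
        positivity
      nlinarith
  nlinarith

theorem contDiff_tl_comp {d : ℕ} {v : (Fin d → ℝ) → ℝ} (hv : ContDiff ℝ 1 v)
    (hv0 : ∀ x, 0 < v x) {δ : ℝ} (hδ : 0 < δ) :
    ContDiff ℝ 1 (fun x => tl δ (v x)) ∧ ContDiff ℝ 1 (fun x => tl' δ (v x)) := by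
  have e1 : ∀ x, 1 + v x ≠ 0 := fun x => by have := hv0 x; positivity
  have e2 : ∀ x, 1 + δ * v x ≠ 0 := fun x => by have := hv0 x; positivity
  have c1 : ContDiff ℝ 1 (fun x => 1 + v x) := contDiff_const.add hv
  have c2 : ContDiff ℝ 1 (fun x => 1 + δ * v x) := contDiff_const.add (contDiff_const.mul hv)
  constructor
  · unfold tl
    exact (c1.log e1).sub (c2.log e2)
  · unfold tl'
    exact contDiff_const.div (c1.mul c2) fun x => mul_ne_zero (e1 x) (e2 x)

theorem tl_tendsto (v : ℝ) :
    Tendsto (fun n : ℕ => tl (1 / ((n : ℝ) + 1)) v) atTop (nhds (Real.log (1 + v))) := by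
  have h1 : Tendsto (fun n : ℕ => 1 + 1 / ((n : ℝ) + 1) * v) atTop (nhds (1 + 0 * v)) :=
    (tendsto_one_div_add_atTop_nhds_zero_nat.mul_const v).const_add 1
  have h2 := (h1.log (by norm_num)).const_sub (Real.log (1 + v))
  simpa [tl] using h2

theorem entropy_bound {d : ℕ} {c r D κ : ℝ} {a : Fin d → Fin d → (Fin d → ℝ) → ℝ}
    {b b0 : Fin d → (Fin d → ℝ) → ℝ} {P : Matrix (Fin d) (Fin d) ℝ}
    (H : LyapBounds c r D a b P) (hb0 : ∀ k, ContDiff ℝ 1 (b0 k)) (hκ : 0 < κ)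
    (hell : ∀ x (ξ : Fin d → ℝ), κ * (ξ ⬝ᵥ ξ) ≤ ∑ k, ∑ l, a k l x * ξ k * ξ l)
    (hH : ∀ x, (fun k => b k x - b0 k x) ⬝ᵥ (fun k => b k x - b0 k x) ≤ D * qf P x)
    (hHP : ∀ x, |∑ k, (b k x - b0 k x) * (2 * (P *ᵥ x) k)| ≤ D * qf P x)
    (ρ0 ρ1 : (Fin d → ℝ) → ℝ) (hρ0 : ContDiff ℝ 2 ρ0) (hρ1 : ContDiff ℝ 2 ρ1)
    (hρ0p : ∀ x, 0 < ρ0 x) (hρ1p : ∀ x, 0 < ρ1 x) (hρi : Integrable ρ1)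
    (hFP0 : ∀ x, (0 : ℝ) = -(∑ k, pd k (fun y => b0 k y * ρ0 y) x) +
        c * ∑ k, ∑ l, pd k (pd l (fun y => a k l y * ρ0 y)) x)
    (hFP : ∀ x, (0 : ℝ) = -(∑ k, pd k (fun y => b k y * ρ1 y) x) +
        c * ∑ k, ∑ l, pd k (pd l (fun y => a k l y * ρ1 y)) x) :
    Integrable (fun x => ρ1 x * Real.log (1 + ρ1 x / ρ0 x)) := by
  have hr := H.hr
  have hc := H.hc
  have hD := H.hD
  have hq : Continuous (qf P) := (contDiff_qf (n := 0) P).continuous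
  obtain ⟨v, hvdef⟩ : ∃ v : (Fin d → ℝ) → ℝ, v = fun x => ρ1 x / ρ0 x := ⟨_, rfl⟩
  have hv : ContDiff ℝ 1 v := by
    rw [hvdef]
    exact (hρ1.of_le (by norm_num)).div (hρ0.of_le (by norm_num)) fun x => (hρ0p x).ne'
  have hv0 : ∀ x, 0 < v x := fun x => by rw [hvdef]; exact div_pos (hρ1p x) (hρ0p x)
  have hvρ : ∀ x, ρ1 x = v x * ρ0 x := fun x => by
    rw [hvdef]; exact (div_mul_cancel₀ _ (hρ0p x).ne').symm
  have hvd : ∀ x, DifferentiableAt ℝ v x := fun x =>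
    (hv.differentiable (by norm_num)).differentiableAt
  have hlogc : Continuous fun x => ρ1 x * Real.log (1 + v x) :=
    hρ1.continuous.mul ((continuous_const.add hv.continuous).log fun x => by
      have := hv0 x; exact ne_of_gt (show (0 : ℝ) < 1 + v x by positivity))
  let A : Set (Fin d → ℝ) := {x | qf P x ≤ 2}
  let ind : (Fin d → ℝ) → ℝ := A.indicator fun _ => 1
  have hA : IsCompact A := hasCompactSupport_qf P H.hP1 2
  have hindI : Integrable (fun x => ind x * (ρ1 x * Real.log (1 + v x))) := by
    have h1 : IntegrableOn (fun x => ρ1 x * Real.log (1 + v x)) A :=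
      hlogc.continuousOn.integrableOn_compact hA
    rw [← integrable_indicator_iff hA.measurableSet] at h1
    refine h1.congr (Eventually.of_forall fun x => ?_)
    by_cases hx : x ∈ A <;> simp [ind, hx]
  have hind0 : ∀ x, 0 ≤ ind x := fun x => Set.indicator_nonneg (fun _ _ => zero_le_one) x
  have hind1 : ∀ x, qf P x ≤ 2 → ind x = 1 := fun x hx =>
    Set.indicator_of_mem (show x ∈ A from hx) _
  have hmom := moment_bound H ρ1 hρ1 hρ1p hρi hFP
  have hmom1 : Integrable (fun x => ρ1 x * qf P x) := by
    refine (hρi.add hmom).mono' (hρ1.continuous.mul hq).aestronglyMeasurable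
      (Eventually.of_forall fun x => ?_)
    have h1 := H.hV x
    have h2 := (hρ1p x).le
    rw [Real.norm_eq_abs, abs_of_nonneg (by positivity), Pi.add_apply]
    nlinarith [mul_nonneg h2 (sq_nonneg (qf P x - 1))]
  let K1 := 3 * D + 9 * r
  let K2 := D / (2 * c * κ) + K1 + 4 * D
  have hmom2 : Integrable (fun x => ρ1 x * (K2 * (1 + qf P x) ^ 2)) := by
    have h1 := ((hρi.add (hmom1.const_mul 2)).add hmom).const_mul K2
    refine h1.congr (Eventually.of_forall fun x => ?_)
    simp only [Pi.add_apply]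
    ring
  have hR : Integrable (fun x => ρ1 x * (K2 * (1 + qf P x) ^ 2) +
      2 * r * (ind x * (ρ1 x * Real.log (1 + v x)))) := hmom2.add (hindI.const_mul _)
  have key : ∀ n : ℕ, ∃ E : (Fin d → ℝ) → ℝ, Integrable E ∧ ∫ x, E x = 0 ∧ ∀ x,
      ρ1 x * (r * tl (1 / ((n : ℝ) + 1)) (v x) *
        (max ((n + 1 : ℝ) - qf P x) 0 / (n + 1 : ℝ)) ^ 3) ≤
      E x + (ρ1 x * (K2 * (1 + qf P x) ^ 2) +
      2 * r * (ind x * (ρ1 x * Real.log (1 + v x)))) := by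
    intro n
    obtain ⟨N, hN⟩ : ∃ N : ℝ, N = (n : ℝ) + 1 := ⟨_, rfl⟩
    have hN1 : 1 ≤ N := by rw [hN]; linarith [(Nat.cast_nonneg n : (0 : ℝ) ≤ n)]
    have hN0 : 0 < N := by linarith
    rw [← hN]
    obtain ⟨δ, hδdef⟩ : ∃ δ : ℝ, δ = 1 / N := ⟨_, rfl⟩
    have hδ : 0 < δ := by rw [hδdef]; positivity
    have hδ1 : δ ≤ 1 := by rw [hδdef, div_le_one hN0]; exact hN1
    rw [← hδdef]
    let w : ℝ → ℝ := fun t => t * max (N - t) 0 ^ 3 / N ^ 3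
    let w' : ℝ → ℝ := fun t => (max (N - t) 0 ^ 3 - 3 * t * max (N - t) 0 ^ 2) / N ^ 3
    let w'' : ℝ → ℝ := fun t => (-6 * max (N - t) 0 ^ 2 + 6 * t * max (N - t) 0) / N ^ 3
    have h1 : ∀ t, HasDerivAt w (w' t) t := fun t =>
      (((hasDerivAt_id t).fun_mul (hasDerivAt_trunc_pow N 1 t)).div_const (N ^ 3)).congr_deriv
        (by simp only [w', id]; push_cast; ring)
    have h2 : ∀ t, HasDerivAt w' (w'' t) t := fun t =>
      (((hasDerivAt_trunc_pow N 1 t).sub (((hasDerivAt_id t).const_mul 3).fun_mul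
        (hasDerivAt_trunc_pow N 0 t))).div_const (N ^ 3)).congr_deriv
        (by simp only [w'', id]; push_cast; ring)
    have h3 : Continuous w'' := by simp only [w'']; fun_prop
    have hw2 : ContDiff ℝ 2 w := contDiff_two_of h1 h2 h3
    have hW2 : ContDiff ℝ 2 (fun x => w (qf P x)) := hw2.comp (contDiff_qf P)
    have hWc : HasCompactSupport (fun x => w (qf P x)) :=
      compact_comp P H.hP1 w N fun t ht => by
        simp only [w]; rw [max_eq_right (by linarith)]; simp
    have hct := contDiff_tl_comp hv hv0 hδ
    obtain ⟨E, hE1, hE2, hE3⟩ := int_identity c a H.ha H.hsymm b0 b hb0 H.hb ρ0 ρ1 v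
      hρ0 hρ1 hv hvρ hFP0 hFP (fun x => tl δ (v x) + v x * tl' δ (v x))
      (fun x => -(v x ^ 2 * tl' δ (v x))) (fun x => tq δ (v x))
      (hct.1.add (hv.mul hct.2)) ((hv.pow 2).mul hct.2).neg
      (fun k x => pd_comp (hasDerivAt_tS hδ (hv0 x)) (hvd x))
      (fun k x => by
        rw [pd_comp (g := fun y => -(y ^ 2 * tl' δ y)) (hasDerivAt_tT hδ (hv0 x)) (hvd x)]; ring)
      _ hW2 hWc
    refine ⟨E, hE1, hE2, fun x => ?_⟩
    have hg := gen_comp P H.hP h1 h2 x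
    have hx := hE3 x
    simp only [hg.1, hg.2] at hx
    rw [gen_split (fun k l => a k l x) P (fun k => b k x) (P *ᵥ x)] at hx
    obtain ⟨f1, f2, f3, f4⟩ := trunc_facts (u := max (N - qf P x) 0) hr hD H.hcD hc (H.hV x) hN1
      (H.hβ x) (H.hβ' x) (H.hτ x) (H.hΓ0 x) (H.hΓ x) rfl
    obtain ⟨g1, g2, g3, g4, g5, g6, g7⟩ := tl_facts hδ hδ1 (hv0 x)
    have hδN : 1 / δ = N := by rw [hδdef]; simp
    rw [hδN] at g5
    have hp0 := hρ0p x
    have hvx := hv0 x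
    have hu0 : 0 ≤ max (N - qf P x) 0 := le_max_right _ _
    have huN : max (N - qf P x) 0 ≤ N := max_le (by linarith [H.hV x]) hN0.le
    have hgr := grad_scalar (v := v x) (fun k => b k x - b0 k x) (fun k => pd k v x) hc hκ hp0
      (hell x (fun k => pd k v x)) (hH x)
    have hes := entropy_scalar (p0 := ρ0 x) (p1 := ρ1 x) (v := v x) (W := w (qf P x))
      (q := tq δ (v x)) (T := -(v x ^ 2 * tl' δ (v x)))
      (S := tl δ (v x) + v x * tl' δ (v x)) (l := tl δ (v x)) (Lg := Real.log (1 + v x))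
      (HW := ∑ k, (b k x - b0 k x) * (w' (qf P x) * (2 * (P *ᵥ x) k)))
      (ind := ind x) (K1 := K1)
      hp0 hvx (hvρ x) f1 f2 g1 g2 hc hκ hD hr hN1 (by positivity) hgr
      (by rw [hvρ x]; ring)
      (by
        have e : ρ0 x * -(v x ^ 2 * tl' δ (v x)) = -(ρ1 x * (v x * tl' δ (v x))) := by
          rw [hvρ x]; ring
        rw [e, abs_neg, abs_of_nonneg (mul_nonneg (hρ1p x).le g6)]
        exact mul_le_of_le_one_right (hρ1p x).le g7)
      f4
      (by
        have e : ∑ k, (b k x - b0 k x) * (w' (qf P x) * (2 * (P *ᵥ x) k)) =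
            w' (qf P x) * ∑ k, (b k x - b0 k x) * (2 * (P *ᵥ x) k) := by
          rw [Finset.mul_sum]; exact Finset.sum_congr rfl fun k _ => by ring
        rw [e, abs_mul]
        exact mul_le_mul f3 (hHP x) (abs_nonneg _) (by norm_num))
      g3 g5 g4 (by positivity)
      (pow_le_one₀ (by positivity) (by rw [div_le_one hN0]; exact huN))
      (hind0 x) (hind1 x)
    rw [hx, hvρ x]
    rw [hvρ x] at hes
    simp only [w', w'', K2, K1] at hes ⊢
    linarith
  choose E hE1 hE2 hE3 using key
  have hfin : Integrable (fun x => ρ1 x * (r * Real.log (1 + v x) * 1 ^ 3)) := by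
    refine fatou_dom _ _ _ (∫ x, (ρ1 x * (K2 * (1 + qf P x) ^ 2) +
      2 * r * (ind x * (ρ1 x * Real.log (1 + v x))))) ?_ ?_ hE3
      (fun n => (hE1 n).add hR) ?_ ?_
    · intro n
      have h1 : Continuous fun x => tl (1 / ((n : ℝ) + 1)) (v x) :=
        (contDiff_tl_comp hv hv0 (by positivity)).1.continuous
      have := hρ1.continuous
      fun_prop
    · intro n x
      have h1 := (hρ1p x).le
      have h2 := (tl_facts (δ := 1 / ((n : ℝ) + 1)) (by positivity)
        (by rw [div_le_one (by positivity)]; linarith [(Nat.cast_nonneg n : (0 : ℝ) ≤ n)])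
        (hv0 x)).2.2.1
      positivity
    · intro n
      rw [integral_add (hE1 n) hR, hE2, zero_add]
    · intro x
      exact (((tl_tendsto (v x)).const_mul r).mul ((trunc_tendsto (qf P x)).pow 3)).const_mul (ρ1 x)
  refine (hfin.const_mul (1 / r)).congr (Eventually.of_forall fun x => ?_)
  simp only [hvdef]
  field_simp

/-! ### Coefficient bounds -/

theorem dot_abs_le {d : ℕ} (u w : Fin d → ℝ) : |u ⬝ᵥ w| ≤ u ⬝ᵥ u + w ⬝ᵥ w := by
  simp only [dotProduct, ← Finset.sum_add_distrib]
  refine (Finset.abs_sum_le_sum_abs _ _).trans (Finset.sum_le_sum fun i _ => ?_)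
  rw [abs_le]
  constructor <;> nlinarith [sq_nonneg (u i - w i), sq_nonneg (u i + w i), sq_nonneg (u i),
    sq_nonneg (w i)]

theorem quad_bound {d : ℕ} (A B : Matrix (Fin d) (Fin d) ℝ) : ∃ K : ℝ, 0 < K ∧
    ∀ x : Fin d → ℝ, |(A *ᵥ x) ⬝ᵥ (B *ᵥ x)| ≤ K * (x ⬝ᵥ x) := by
  obtain ⟨K1, h1, h1'⟩ := mulVec_sq_le' A
  obtain ⟨K2, h2, h2'⟩ := mulVec_sq_le' B
  refine ⟨K1 + K2, by positivity, fun x => (dot_abs_le _ _).trans ?_⟩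
  linarith [h1' x, h2' x]

theorem sigma_growth {d m : ℕ} (σ : (Fin d → ℝ) → Matrix (Fin d) (Fin m) ℝ)
    (hLip : LipschitzCoeff σ) : ∃ C : ℝ, 0 < C ∧ ∀ x k l,
      |(σ x * (σ x)ᵀ) k l| ≤ C * (1 + x ⬝ᵥ x) := by
  obtain ⟨L, hL⟩ := hLip
  obtain ⟨C0, hC0⟩ : ∃ C0 : ℝ, C0 = ∑ i, ∑ j, |σ 0 i j| + |L| := ⟨_, rfl⟩
  have hS0 : 0 ≤ ∑ i, ∑ j, |σ 0 i j| :=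
    Finset.sum_nonneg fun _ _ => Finset.sum_nonneg fun _ _ => abs_nonneg _
  have hC0' : 0 ≤ C0 := by rw [hC0]; positivity
  have h1 : ∀ x i j, |σ x i j| ≤ C0 * (1 + ‖x‖) := by
    intro x i j
    have h2 := hL x 0 i j
    rw [dist_zero_right] at h2
    have h3 : |σ 0 i j| ≤ ∑ i, ∑ j, |σ 0 i j| :=
      (Finset.single_le_sum (f := fun j => |σ 0 i j|) (fun _ _ => abs_nonneg _)
        (Finset.mem_univ j)).trans
      (Finset.single_le_sum (f := fun i => ∑ j, |σ 0 i j|)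
        (fun _ _ => Finset.sum_nonneg fun _ _ => abs_nonneg _) (Finset.mem_univ i))
    have h4 : |σ x i j| ≤ |σ x i j - σ 0 i j| + |σ 0 i j| := by
      have := abs_add_le (σ x i j - σ 0 i j) (σ 0 i j)
      simpa using this
    have h5 : L * ‖x‖ ≤ |L| * ‖x‖ := mul_le_mul_of_nonneg_right (le_abs_self L) (norm_nonneg x)
    have h6 : 0 ≤ (∑ i, ∑ j, |σ 0 i j|) * ‖x‖ := by positivity
    rw [hC0]
    nlinarith [abs_nonneg L]
  have hnorm : ∀ x : Fin d → ℝ, ‖x‖ ^ 2 ≤ x ⬝ᵥ x := by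
    intro x
    have h0 := dot_self_nonneg x
    have : ‖x‖ ≤ √(x ⬝ᵥ x) := by
      rw [pi_norm_le_iff_of_nonneg (Real.sqrt_nonneg _)]
      intro i
      rw [Real.norm_eq_abs]
      apply Real.abs_le_sqrt
      rw [sq]
      exact Finset.single_le_sum (f := fun i => x i * x i) (fun _ _ => mul_self_nonneg _)
        (Finset.mem_univ i)
    calc ‖x‖ ^ 2 ≤ √(x ⬝ᵥ x) ^ 2 := by gcongr
      _ = _ := Real.sq_sqrt h0
  refine ⟨2 * m * C0 ^ 2 + 1, by positivity, fun x k l => ?_⟩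
  have h0 := dot_self_nonneg x
  have h2 : |(σ x * (σ x)ᵀ) k l| ≤ m * (C0 * (1 + ‖x‖)) ^ 2 := by
    rw [Matrix.mul_apply]
    refine (Finset.abs_sum_le_sum_abs _ _).trans ?_
    calc ∑ j, |σ x k j * (σ x)ᵀ j l| ≤ ∑ j : Fin m, (C0 * (1 + ‖x‖)) ^ 2 := by
          refine Finset.sum_le_sum fun j _ => ?_
          rw [abs_mul, sq, Matrix.transpose_apply]
          exact mul_le_mul (h1 x k j) (h1 x l j) (abs_nonneg _) (by positivity)
      _ = _ := by simp
  have h3 : (1 + ‖x‖) ^ 2 ≤ 2 * (1 + x ⬝ᵥ x) := by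
    nlinarith [hnorm x, sq_nonneg (‖x‖ - 1)]
  have h4 : m * C0 ^ 2 * (1 + ‖x‖) ^ 2 ≤ m * C0 ^ 2 * (2 * (1 + x ⬝ᵥ x)) :=
    mul_le_mul_of_nonneg_left h3 (by positivity)
  nlinarith

theorem dsum_abs {d : ℕ} (a B : Fin d → Fin d → ℝ) (α : ℝ) (h : ∀ k l, |a k l| ≤ α) :
    |∑ k, ∑ l, a k l * B k l| ≤ α * ∑ k, ∑ l, |B k l| := by
  simp only [Finset.mul_sum]
  refine (Finset.abs_sum_le_sum_abs _ _).trans (Finset.sum_le_sum fun k _ => ?_)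
  refine (Finset.abs_sum_le_sum_abs _ _).trans (Finset.sum_le_sum fun l _ => ?_)
  rw [abs_mul]
  exact mul_le_mul_of_nonneg_right (h k l) (abs_nonneg _)

theorem dsum_prod {d : ℕ} (p : Fin d → ℝ) :
    ∑ k, ∑ l, |4 * (p k * p l)| ≤ 4 * d * (p ⬝ᵥ p) := by
  have h1 : ∀ k l, |4 * (p k * p l)| ≤ 2 * (p k * p k) + 2 * (p l * p l) := by
    intro k l
    rw [abs_le]
    constructor <;> nlinarith [sq_nonneg (p k - p l), sq_nonneg (p k + p l)]
  calc ∑ k, ∑ l, |4 * (p k * p l)| ≤ ∑ k, ∑ l, (2 * (p k * p k) + 2 * (p l * p l)) :=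
        Finset.sum_le_sum fun k _ => Finset.sum_le_sum fun l _ => h1 k l
    _ = 4 * d * (p ⬝ᵥ p) := by
        simp only [Finset.sum_add_distrib, Finset.sum_const, Finset.card_univ, Fintype.card_fin,
          nsmul_eq_mul, dotProduct, ← Finset.mul_sum]
        ring

theorem ell_form {d m : ℕ} (σ : (Fin d → ℝ) → Matrix (Fin d) (Fin m) ℝ) (κ : ℝ)
    (hell : UnifElliptic σ κ) (x ξ : Fin d → ℝ) :
    κ * (ξ ⬝ᵥ ξ) ≤ ∑ k, ∑ l, (σ x * (σ x)ᵀ) k l * ξ k * ξ l := by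
  have h1 := (hell x).dotProduct_mulVec_nonneg ξ
  rw [Matrix.sub_mulVec, dotProduct_sub, Matrix.smul_mulVec, Matrix.one_mulVec,
    dotProduct_smul] at h1
  have h2 : star ξ ⬝ᵥ ((σ x * (σ x)ᵀ) *ᵥ ξ) = ∑ k, ∑ l, (σ x * (σ x)ᵀ) k l * ξ k * ξ l := by
    simp only [mulVec, dotProduct, Finset.mul_sum, star_trivial]
    exact Finset.sum_congr rfl fun k _ => Finset.sum_congr rfl fun l _ => by ring
  rw [h2] at h1
  simp only [star_trivial, smul_eq_mul] at h1
  linarith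

theorem lyap_exists {d m : ℕ} (M0 M1 : Matrix (Fin d) (Fin d) ℝ) (hM1 : IsHurwitz M1)
    (σ : (Fin d → ℝ) → Matrix (Fin d) (Fin m) ℝ)
    (hLip : LipschitzCoeff σ) (hC2 : C2Coeff σ)
    (κ : ℝ) (hκ : 0 < κ) (hell : UnifElliptic σ κ) :
    ∃ r > 0, ∃ D > 0, ∃ P : Matrix (Fin d) (Fin d) ℝ,
      (∀ c, 0 < c → c * D ≤ r / 2 → LyapBounds c r D (fun k l x => (σ x * (σ x)ᵀ) k l)
        (fun k x => (M1 *ᵥ x) k) P) ∧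
      (∀ x, (fun k => (M1 *ᵥ x) k - (M0 *ᵥ x) k) ⬝ᵥ (fun k => (M1 *ᵥ x) k - (M0 *ᵥ x) k)
        ≤ D * qf P x) ∧
      (∀ x, |∑ k, ((M1 *ᵥ x) k - (M0 *ᵥ x) k) * (2 * (P *ᵥ x) k)| ≤ D * qf P x) := by
  obtain ⟨P, hP, hP1, r0, hr0, hr1⟩ := exists_lyapunov M1 hM1
  obtain ⟨Λ, hΛ, hΛ'⟩ := quad_bound 1 P
  obtain ⟨K1, hK1, hK1'⟩ := quad_bound M1 P
  obtain ⟨K2, hK2, hK2'⟩ := quad_bound (M1 - M0) P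
  obtain ⟨K3, hK3, hK3'⟩ := quad_bound (M1 - M0) (M1 - M0)
  obtain ⟨K4, hK4, hK4'⟩ := quad_bound P P
  obtain ⟨C, hC, hC'⟩ := sigma_growth σ hLip
  obtain ⟨τ0, hτ0⟩ : ∃ τ0 : ℝ, τ0 = ∑ k, ∑ l, |2 * P l k| := ⟨_, rfl⟩
  have hτ0' : 0 ≤ τ0 := by
    rw [hτ0]; exact Finset.sum_nonneg fun _ _ => Finset.sum_nonneg fun _ _ => abs_nonneg _
  obtain ⟨D, hD⟩ : ∃ D : ℝ, D = 2 * K1 + 2 * K2 + K3 + C * τ0 + C * (4 * d * K4) := ⟨_, rfl⟩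
  have hd0 : (0 : ℝ) ≤ d := Nat.cast_nonneg d
  have p1 : 0 ≤ C * τ0 := by positivity
  have p2 : 0 ≤ C * (4 * d * K4) := by positivity
  have hDpos : 0 < D := by rw [hD]; positivity
  have hxx : ∀ x : Fin d → ℝ, 0 ≤ x ⬝ᵥ x := dot_self_nonneg
  have hxV : ∀ x, x ⬝ᵥ x ≤ qf P x := hP1
  have hV : ∀ x, 0 ≤ qf P x := fun x => (hxx x).trans (hxV x)
  have scale : ∀ (K : ℝ) x, 0 ≤ K → K ≤ D → K * (x ⬝ᵥ x) ≤ D * qf P x := fun K x h0 h =>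
    mul_le_mul h (hxV x) (hxx x) hDpos.le
  have hVΛ : ∀ x, qf P x ≤ Λ * (x ⬝ᵥ x) := fun x => by
    have := (le_abs_self _).trans (hΛ' x)
    rwa [Matrix.one_mulVec] at this
  have e2 : ∀ (M : Matrix (Fin d) (Fin d) ℝ) x,
      ∑ k, (M *ᵥ x) k * (2 * (P *ᵥ x) k) = 2 * ((M *ᵥ x) ⬝ᵥ (P *ᵥ x)) := fun M x => by
    rw [dotProduct, Finset.mul_sum]
    exact Finset.sum_congr rfl fun k _ => by ring
  have hsub : ∀ x, (fun k => (M1 *ᵥ x) k - (M0 *ᵥ x) k) = (M1 - M0) *ᵥ x := fun x => by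
    rw [Matrix.sub_mulVec]; rfl
  refine ⟨r0 / Λ, by positivity, D, hDpos, P, ?_, ?_, ?_⟩
  · intro c hc hcD
    refine ⟨by positivity, hc, hDpos, hcD, ?_, ?_, ?_, hP, hP1, ?_, ?_, ?_, ?_, ?_⟩
    · intro k l
      simp only [Matrix.mul_apply, Matrix.transpose_apply]
      exact ContDiff.sum fun j _ => (hC2 k j).mul (hC2 l j)
    · intro k l
      funext x
      simp only [Matrix.mul_apply, Matrix.transpose_apply]
      exact Finset.sum_congr rfl fun j _ => mul_comm _ _
    · intro k
      exact contDiff_mulVec M1 k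
    · intro x
      rw [e2, dotProduct_comm]
      have h1 := hr1 x
      have h2 : r0 / Λ * qf P x ≤ r0 * (x ⬝ᵥ x) := by
        rw [div_mul_eq_mul_div, div_le_iff₀ hΛ]
        nlinarith [hVΛ x]
      linarith
    · intro x
      rw [e2, abs_mul, abs_two]
      have := scale (2 * K1) x (by positivity) (by rw [hD]; linarith)
      linarith [hK1' x]
    · intro x
      have h1 := dsum_abs (fun k l => (σ x * (σ x)ᵀ) k l) (fun k l => 2 * P l k) _ (hC' x)
      rw [← hτ0] at h1
      refine h1.trans ?_
      have h2 : C * τ0 * (1 + x ⬝ᵥ x) ≤ D * (1 + qf P x) :=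
        mul_le_mul (by rw [hD]; linarith) (by linarith [hxV x]) (by linarith [hxx x]) hDpos.le
      linarith
    · intro x
      have h1 := ell_form σ κ hell x (P *ᵥ x)
      have h2 : 0 ≤ κ * ((P *ᵥ x) ⬝ᵥ (P *ᵥ x)) := mul_nonneg hκ.le (hxx _)
      have h3 : ∑ k, ∑ l, (σ x * (σ x)ᵀ) k l * (4 * ((P *ᵥ x) k * (P *ᵥ x) l)) =
          4 * ∑ k, ∑ l, (σ x * (σ x)ᵀ) k l * (P *ᵥ x) k * (P *ᵥ x) l := by
        simp only [Finset.mul_sum]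
        exact Finset.sum_congr rfl fun k _ => Finset.sum_congr rfl fun l _ => by ring
      rw [h3]
      linarith
    · intro x
      have h1 := dsum_abs (fun k l => (σ x * (σ x)ᵀ) k l)
        (fun k l => 4 * ((P *ᵥ x) k * (P *ᵥ x) l)) _ (hC' x)
      refine ((le_abs_self _).trans h1).trans ?_
      have h2 := dsum_prod (P *ᵥ x)
      have h3 : (P *ᵥ x) ⬝ᵥ (P *ᵥ x) ≤ K4 * (x ⬝ᵥ x) := (le_abs_self _).trans (hK4' x)
      have h4 : 4 * d * ((P *ᵥ x) ⬝ᵥ (P *ᵥ x)) ≤ 4 * d * (K4 * (x ⬝ᵥ x)) :=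
        mul_le_mul_of_nonneg_left h3 (by positivity)
      have hx0 := hxx x
      have hVx := hV x
      calc C * (1 + x ⬝ᵥ x) * ∑ k, ∑ l, |4 * ((P *ᵥ x) k * (P *ᵥ x) l)|
          ≤ C * (1 + x ⬝ᵥ x) * (4 * d * (K4 * (x ⬝ᵥ x))) :=
            mul_le_mul_of_nonneg_left (h2.trans h4) (by positivity)
        _ = C * (4 * d * K4) * (1 + x ⬝ᵥ x) * (x ⬝ᵥ x) := by ring
        _ ≤ D * (1 + qf P x) * qf P x := by
            apply mul_le_mul _ (hxV x) hx0 (by positivity)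
            apply mul_le_mul (by rw [hD]; linarith) (by linarith [hxV x]) (by positivity) hDpos.le
  · intro x
    rw [hsub]
    have := scale K3 x (by positivity) (by rw [hD]; linarith)
    linarith [(le_abs_self _).trans (hK3' x)]
  · intro x
    have h1 : ∑ k, ((M1 *ᵥ x) k - (M0 *ᵥ x) k) * (2 * (P *ᵥ x) k) =
        ∑ k, ((M1 - M0) *ᵥ x) k * (2 * (P *ᵥ x) k) := by rw [← hsub]
    rw [h1, e2, abs_mul, abs_two]
    have := scale (2 * K2) x (by positivity) (by rw [hD]; linarith)
    linarith [hK2' x]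

theorem single_channel {d m : ℕ} (M0 M1 : Matrix (Fin d) (Fin d) ℝ) (hM1 : IsHurwitz M1)
    (σ : (Fin d → ℝ) → Matrix (Fin d) (Fin m) ℝ)
    (hLip : LipschitzCoeff σ) (hC2 : C2Coeff σ)
    (κ : ℝ) (hκ : 0 < κ) (hell : UnifElliptic σ κ) :
    ∃ ε₀ > 0, ∀ ε : ℝ, 0 < ε → ε < ε₀ → ∀ ρ0 ρi : (Fin d → ℝ) → ℝ,
        NiceDensity ρ0 → StatFP M0 σ ε ρ0 → NiceDensity ρi → StatFP M1 σ ε ρi →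
        Integrable (fun x => ρi x * Real.logb 2 (ρi x / ρ0 x)) := by
  obtain ⟨r, hr, D, hD, P, h1, h2, h3⟩ := lyap_exists M0 M1 hM1 σ hLip hC2 κ hκ hell
  refine ⟨min 1 (r / D), lt_min one_pos (by positivity), fun ε hε hε1 ρ0 ρ1 n0 f0 n1 f1 => ?_⟩
  obtain ⟨s0, q0, i0⟩ := n0
  obtain ⟨s1, q1, i1⟩ := n1
  have hI : ∀ ρ : (Fin d → ℝ) → ℝ, (∫ x, ρ x) = 1 → Integrable ρ := fun ρ h => by
    by_contra hc
    rw [integral_undef hc] at h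
    exact zero_ne_one h
  have c0 : ContDiff ℝ 2 ρ0 := by exact_mod_cast contDiff_infty.1 s0 2
  have c1 : ContDiff ℝ 2 ρ1 := by exact_mod_cast contDiff_infty.1 s1 2
  have hc : 0 < ε ^ 2 / 2 := by positivity
  have hcD : ε ^ 2 / 2 * D ≤ r / 2 := by
    have e1 : ε < 1 := hε1.trans_le (min_le_left _ _)
    have e2 : ε < r / D := hε1.trans_le (min_le_right _ _)
    rw [lt_div_iff₀ hD] at e2
    have e3 : ε ^ 2 ≤ ε := by nlinarith
    have e4 : ε ^ 2 * D ≤ ε * D := mul_le_mul_of_nonneg_right e3 hD.le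
    linarith
  have hlog := entropy_bound (h1 _ hc hcD) (b0 := fun k x => (M0 *ᵥ x) k)
    (fun k => contDiff_mulVec M0 k) hκ (ell_form σ κ hell) h2 h3 ρ0 ρ1 c0 c1 q0 q1 (hI _ i1) f0 f1
  have hcont : Continuous fun x => ρ1 x * Real.log (ρ1 x / ρ0 x) :=
    c1.continuous.mul ((c1.continuous.div₀ c0.continuous fun x => (q0 x).ne').log fun x =>
      (div_pos (q1 x) (q0 x)).ne')
  have hmain : Integrable (fun x => ρ1 x * Real.log (ρ1 x / ρ0 x)) := by
    refine (hlog.add (hI _ i0)).mono' hcont.aestronglyMeasurable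
      (Eventually.of_forall fun x => ?_)
    have a0 := q0 x
    have a1 := q1 x
    have hv : 0 < ρ1 x / ρ0 x := div_pos a1 a0
    simp only [Pi.add_apply]
    rw [Real.norm_eq_abs, abs_le]
    have u1 : Real.log (ρ1 x / ρ0 x) ≤ Real.log (1 + ρ1 x / ρ0 x) :=
      Real.log_le_log hv (by linarith)
    have u2 : 0 ≤ Real.log (1 + ρ1 x / ρ0 x) := Real.log_nonneg (by linarith)
    have u3 : -Real.log (ρ1 x / ρ0 x) ≤ ρ0 x / ρ1 x := by
      rw [← Real.log_inv, inv_div]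
      exact Real.log_le_self (by positivity)
    have u4 : ρ1 x * (ρ0 x / ρ1 x) = ρ0 x := by field_simp
    have u5 := mul_le_mul_of_nonneg_left u1 a1.le
    have u6 := mul_le_mul_of_nonneg_left u3 a1.le
    have u7 := mul_nonneg a1.le u2
    constructor <;> linarith
  refine (hmain.div_const (Real.log 2)).congr (Eventually.of_forall fun x => ?_)
  simp only [Real.logb]
  ring

/-- Under the reliable stabilization and ellipticity hypotheses,
for all sufficiently small `ε > 0`, if `ρ0` is the smooth positive stationary
Fokker-Planck density for the nominal closed loop and `ρi` the one for the
channel-`i`-failure closed loop, then the relative entropy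
`D(μ⁽ᵉ'ⁱ⁾ ‖ μ⁽ᵉ'⁰⁾) = ∫ ρi log₂(ρi/ρ0)` is finite (the integrand is integrable). -/
theorem stmt3 (d m N : ℕ) (r : Fin N → ℕ)
    (A : Matrix (Fin d) (Fin d) ℝ)
    (B : ∀ i : Fin N, Matrix (Fin d) (Fin (r i)) ℝ)
    (K : ∀ i : Fin N, Matrix (Fin (r i)) (Fin d) ℝ)
    (hnom : IsHurwitz (A + ∑ i, B i * K i))
    (hfail : ∀ j, IsHurwitz (A + ∑ i ∈ Finset.univ.erase j, B i * K i))
    (σ : (Fin d → ℝ) → Matrix (Fin d) (Fin m) ℝ)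
    (hLip : LipschitzCoeff σ) (hC2 : C2Coeff σ)
    (κ : ℝ) (hκ : 0 < κ) (hell : UnifElliptic σ κ) :
    ∃ ε₀ > 0, ∀ ε : ℝ, 0 < ε → ε < ε₀ →
      ∀ i : Fin N, ∀ ρ0 ρi : (Fin d → ℝ) → ℝ,
        NiceDensity ρ0 → StatFP (A + ∑ i, B i * K i) σ ε ρ0 →
        NiceDensity ρi → StatFP (A + ∑ k ∈ Finset.univ.erase i, B k * K k) σ ε ρi →
        Integrable (fun x => ρi x * Real.logb 2 (ρi x / ρ0 x)) := by
  have h : ∀ i : Fin N, ∀ᶠ e in nhdsWithin (0 : ℝ) (Set.Ioi 0), ∀ ε : ℝ, 0 < ε → ε < e →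
      ∀ ρ0 ρi : (Fin d → ℝ) → ℝ,
        NiceDensity ρ0 → StatFP (A + ∑ i, B i * K i) σ ε ρ0 →
        NiceDensity ρi → StatFP (A + ∑ k ∈ Finset.univ.erase i, B k * K k) σ ε ρi →
        Integrable (fun x => ρi x * Real.logb 2 (ρi x / ρ0 x)) := by
    intro i
    obtain ⟨e0, he0, he⟩ := single_channel (A + ∑ i, B i * K i) _ (hfail i) σ hLip hC2 κ hκ hell
    filter_upwards [Ioo_mem_nhdsGT he0] with e hee ε h1 h2
    exact he ε h1 (h2.trans hee.2)
  have h' := (eventually_all.2 h).and (self_mem_nhdsWithin)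
  obtain ⟨e, he, he0⟩ := h'.exists
  exact ⟨e, he0, fun ε h1 h2 i => he i ε h1 h2⟩
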